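/- arXiv:1402.1504 — 5 statements merged into one kernel-verified Lean document; each statement's English description precedes it below -/
import Mathlib

section
/- Let F be a field of characteristic zero, G a finite group, A a finite-dimensional F-vector space equipped with an F-linear action of G, and γ : A → A an F-linear endomorphism that commutes with the action of every element of G. Then the subspace ker(γ - id) (with its induced G-action) and the quotient space A / (γ - id)(A) (with its induced G-action) are isomorphic as F[G]-modules, i.e. there is an F-linear G-equivariant bijection between them. -/
universe u

/-- The space of linear maps over an `F`-algebra between modules that are finite-dimensional
over `F` is finite-dimensional. -/
theorem LinearMap.finiteDimensional_of_isScalarTower (F : Type*) {R M N : Type*} [Field F] [Ring R]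
    [Algebra F R] [AddCommGroup M] [Module F M] [Module R M] [IsScalarTower F R M]
    [AddCommGroup N] [Module F N] [Module R N] [IsScalarTower F R N]
    [FiniteDimensional F M] [FiniteDimensional F N] : Module.Finite F (M →ₗ[R] N) :=
  Module.Finite.of_injective (LinearMap.restrictScalarsₗ F R M N F)
    (LinearMap.restrictScalars_injective F)

theorem LinearMap.finrank_prod_right (F : Type*) {R S M N : Type*} [Field F] [Ring R]
    [Algebra F R] [AddCommGroup S] [Module F S] [Module R S] [IsScalarTower F R S]
    [AddCommGroup M] [Module F M] [Module R M] [IsScalarTower F R M]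
    [AddCommGroup N] [Module F N] [Module R N] [IsScalarTower F R N]
    [FiniteDimensional F S] [FiniteDimensional F M] [FiniteDimensional F N] :
    Module.finrank F (S →ₗ[R] M × N) =
      Module.finrank F (S →ₗ[R] M) + Module.finrank F (S →ₗ[R] N) := by
  have := LinearMap.finiteDimensional_of_isScalarTower F (R := R) (M := S) (N := M)
  have := LinearMap.finiteDimensional_of_isScalarTower F (R := R) (M := S) (N := N)
  rw [← (LinearMap.prodEquiv F (R := R) (M := S) (M₂ := M) (M₃ := N)).finrank_eq,
    Module.finrank_prod]

theorem LinearEquiv.finrank_hom_eq (F : Type*) {R M N : Type*} (S : Type*) [Field F] [Ring R]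
    [Algebra F R] [AddCommGroup S] [Module R S]
    [AddCommGroup M] [Module F M] [Module R M] [IsScalarTower F R M]
    [AddCommGroup N] [Module F N] [Module R N] [IsScalarTower F R N] (e : M ≃ₗ[R] N) :
    Module.finrank F (S →ₗ[R] M) = Module.finrank F (S →ₗ[R] N) :=
  LinearEquiv.finrank_eq
    { toFun := fun f => e.toLinearMap ∘ₗ f
      invFun := fun f => e.symm.toLinearMap ∘ₗ f
      map_add' := fun f g => by ext; simp
      map_smul' := fun c f => by
        ext x
        exact (e.toLinearMap.restrictScalars F).map_smul c (f x)
      left_inv := fun f => by ext; simp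
      right_inv := fun f => by ext; simp }

/-- Finite-dimensional modules over a semisimple algebra are determined by the dimensions of the
spaces of homomorphisms into them. -/
theorem IsSemisimpleRing.nonempty_linearEquiv_of_finrank_hom_eq {F R : Type*} [Field F] [Ring R]
    [Algebra F R] [IsSemisimpleRing R] {M N : Type u}
    [AddCommGroup M] [Module F M] [Module R M] [IsScalarTower F R M] [FiniteDimensional F M]
    [AddCommGroup N] [Module F N] [Module R N] [IsScalarTower F R N] [FiniteDimensional F N]
    (h : ∀ (S : Type u) [AddCommGroup S] [Module F S] [Module R S] [IsScalarTower F R S]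
      [FiniteDimensional F S],
      Module.finrank F (S →ₗ[R] M) = Module.finrank F (S →ₗ[R] N)) :
    Nonempty (M ≃ₗ[R] N) := by
  induction hn : Module.finrank F M using Nat.strong_induction_on generalizing M N with
  | _ n ih =>
  rcases subsingleton_or_nontrivial M with hM | hM
  · have := LinearMap.finiteDimensional_of_isScalarTower F (R := R) (M := N) (N := N)
    have h0 := h N
    rw [Module.finrank_zero_of_subsingleton] at h0
    have := Module.finrank_zero_iff.mp h0.symm
    have : Subsingleton N := ⟨fun x y => by
      have hid : (LinearMap.id : N →ₗ[R] N) = 0 := Subsingleton.elim _ _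
      rw [← LinearMap.id_apply (R := R) x, ← LinearMap.id_apply (R := R) y, hid]
      rfl⟩
    exact ⟨0⟩
  · obtain ⟨S, hS⟩ := IsSemisimpleModule.exists_simple_submodule R M
    have : FiniteDimensional F S :=
      inferInstanceAs (FiniteDimensional F (S.restrictScalars F))
    have := LinearMap.finiteDimensional_of_isScalarTower F (R := R) (M := S) (N := M)
    have : Nontrivial S := IsSimpleModule.nontrivial R S
    have hSM : 0 < Module.finrank F (S →ₗ[R] M) := by
      have : Nontrivial (S →ₗ[R] M) := by
        refine ⟨S.subtype, 0, fun h0 => ?_⟩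
        obtain ⟨x, hx⟩ := exists_ne (0 : S)
        exact hx (Subtype.ext (LinearMap.congr_fun h0 x))
      exact Module.finrank_pos
    have : Nontrivial (S →ₗ[R] N) := Module.nontrivial_of_finrank_pos (R := F) (h S ▸ hSM)
    obtain ⟨f, hf⟩ := exists_ne (0 : S →ₗ[R] N)
    have hfi : Function.Injective f := LinearMap.injective_of_ne_zero hf
    obtain ⟨P, hP⟩ := exists_isCompl S
    obtain ⟨Q, hQ⟩ := exists_isCompl (LinearMap.range f)
    have : FiniteDimensional F P :=
      inferInstanceAs (FiniteDimensional F (P.restrictScalars F))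
    have : FiniteDimensional F Q :=
      inferInstanceAs (FiniteDimensional F (Q.restrictScalars F))
    let eM : (S × P) ≃ₗ[R] M := Submodule.prodEquivOfIsCompl S P hP
    let eN : (S × Q) ≃ₗ[R] N := (LinearEquiv.prodCongr (LinearEquiv.ofInjective f hfi)
      (LinearEquiv.refl R Q)).trans (Submodule.prodEquivOfIsCompl _ Q hQ)
    have hlt : Module.finrank F P < n := by
      rw [← hn, ← (eM.restrictScalars F).finrank_eq, Module.finrank_prod]
      have : 0 < Module.finrank F S := Module.finrank_pos
      omega
    obtain ⟨e⟩ := ih _ hlt (M := P) (N := Q) (fun T _ _ _ _ _ => by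
      have hT := h T
      rw [← eM.finrank_hom_eq F T, ← eN.finrank_hom_eq F T, LinearMap.finrank_prod_right F,
        LinearMap.finrank_prod_right F] at hT
      exact Nat.add_left_cancel hT) rfl
    exact ⟨eM.symm.trans ((LinearEquiv.prodCongr (LinearEquiv.refl R S) e).trans eN)⟩

/-- Over a semisimple algebra, the kernel and the cokernel of an endomorphism of a
finite-dimensional module are isomorphic. -/
theorem IsSemisimpleRing.nonempty_ker_linearEquiv_coker (F : Type*) {R : Type*} {M : Type u}
    [Field F] [Ring R] [Algebra F R] [IsSemisimpleRing R]
    [AddCommGroup M] [Module F M] [Module R M] [IsScalarTower F R M] [FiniteDimensional F M]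
    (f : M →ₗ[R] M) : Nonempty (LinearMap.ker f ≃ₗ[R] M ⧸ LinearMap.range f) := by
  obtain ⟨D, hD⟩ := exists_isCompl (LinearMap.ker f)
  obtain ⟨C, hC⟩ := exists_isCompl (LinearMap.range f)
  have (P : Submodule R M) : FiniteDimensional F P :=
    inferInstanceAs (FiniteDimensional F (P.restrictScalars F))
  let eD : D ≃ₗ[R] LinearMap.range f :=
    (Submodule.quotientEquivOfIsCompl _ D hD).symm.trans f.quotKerEquivRange
  let eK : (LinearMap.ker f × LinearMap.range f) ≃ₗ[R] M :=
    (LinearEquiv.prodCongr (LinearEquiv.refl R _) eD.symm).trans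
      (Submodule.prodEquivOfIsCompl _ D hD)
  let eC : (C × LinearMap.range f) ≃ₗ[R] M := Submodule.prodEquivOfIsCompl C _ hC.symm
  obtain ⟨e⟩ := nonempty_linearEquiv_of_finrank_hom_eq (F := F) (R := R)
    (M := LinearMap.ker f) (N := C) (fun S _ _ _ _ _ => by
      have h := (eK.trans eC.symm).finrank_hom_eq F S
      rw [LinearMap.finrank_prod_right F, LinearMap.finrank_prod_right F] at h
      exact Nat.add_right_cancel h)
  exact ⟨e.trans (Submodule.quotientEquivOfIsCompl _ C hC).symm⟩

/-- For a finite group in characteristic zero, the kernel and the cokernel of an equivariant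
endomorphism of a finite-dimensional representation are equivariantly isomorphic. -/
theorem Representation.exists_ker_linearEquiv_coker {F G A : Type*} [Field F] [CharZero F]
    [Group G] [Finite G] [AddCommGroup A] [Module F A] [FiniteDimensional F A]
    (ρ : Representation F G A) (f : A →ₗ[F] A) (hf : ∀ g : G, f ∘ₗ ρ g = ρ g ∘ₗ f) :
    ∃ e : LinearMap.ker f ≃ₗ[F] (A ⧸ LinearMap.range f),
      ∀ (g : G) (x y : LinearMap.ker f) (a : A), (y : A) = ρ g x →
        e x = Submodule.Quotient.mk a → e y = Submodule.Quotient.mk (ρ g a) := by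
  have : NeZero (Nat.card G : F) := ⟨Nat.cast_ne_zero.mpr Nat.card_pos.ne'⟩
  let φ : ρ.asModule →ₗ[MonoidAlgebra F G] ρ.asModule :=
    Representation.IntertwiningMap.equivLinearMapAsModule ρ ρ ⟨f, hf⟩
  obtain ⟨e⟩ := IsSemisimpleRing.nonempty_ker_linearEquiv_coker F φ
  have hsmul (g : G) (y : ρ.asModule) :
      MonoidAlgebra.single g (1 : F) • y = ρ.asModuleEquiv.symm (ρ g (ρ.asModuleEquiv y)) := by
    rw [Representation.single_smul, one_smul]
    rfl
  have he (g : G) (x y : LinearMap.ker φ) (a : ρ.asModule)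
      (hy : (y : ρ.asModule) = ρ.asModuleEquiv.symm (ρ g (ρ.asModuleEquiv x)))
      (ha : e x = Submodule.Quotient.mk a) :
      e y = Submodule.Quotient.mk (ρ.asModuleEquiv.symm (ρ g (ρ.asModuleEquiv a))) := by
    have hy' : y = MonoidAlgebra.single g (1 : F) • x := by
      ext
      rw [hy, ← hsmul, Submodule.coe_smul]
    rw [hy', map_smul, ha, ← Submodule.Quotient.mk_smul, hsmul]
  exact ⟨e.restrictScalars F, he⟩

/-- if `γ` is an `F`-linear endomorphism of a finite-dimensional
`F`-vector space `A` (char `F` = 0) commuting with a linear action `ρ` of a finite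
group `G`, then `ker (γ - id)` and `A ⧸ range (γ - id)` are isomorphic as
`F[G]`-modules, i.e. there is a `G`-equivariant `F`-linear bijection. -/
theorem stmt0 {F G A : Type*} [Field F] [CharZero F] [Group G] [Finite G]
    [AddCommGroup A] [Module F A] [FiniteDimensional F A]
    (ρ : Representation F G A) (γ : A →ₗ[F] A)
    (hcomm : ∀ g : G, γ ∘ₗ ρ g = ρ g ∘ₗ γ) :
    ∃ e : LinearMap.ker (γ - LinearMap.id) ≃ₗ[F]
        (A ⧸ LinearMap.range (γ - LinearMap.id)),
      ∀ (g : G) (x : LinearMap.ker (γ - LinearMap.id)),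
        e ⟨ρ g x.1, by
          have hx : (γ - (LinearMap.id : A →ₗ[F] A)) x.1 = 0 := x.2
          have h := LinearMap.congr_fun (hcomm g) x.1
          simp only [LinearMap.sub_apply, LinearMap.id_apply,
            LinearMap.comp_apply] at hx h
          simp only [LinearMap.mem_ker, LinearMap.sub_apply, LinearMap.id_apply]
          rw [h, ← map_sub, hx, map_zero]⟩ =
        Submodule.mapQ (LinearMap.range (γ - LinearMap.id))
          (LinearMap.range (γ - LinearMap.id)) (ρ g)
          (by
            rintro y ⟨a, rfl⟩
            simp only [Submodule.mem_comap, LinearMap.mem_range]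
            refine ⟨ρ g a, ?_⟩
            have h := LinearMap.congr_fun (hcomm g) a
            simp only [LinearMap.sub_apply, LinearMap.id_apply,
              LinearMap.comp_apply] at h ⊢
            rw [h, map_sub])
          (e x) := by
  obtain ⟨e, he⟩ := ρ.exists_ker_linearEquiv_coker (γ - LinearMap.id) fun g => by
    rw [LinearMap.sub_comp, LinearMap.comp_sub, hcomm g, LinearMap.id_comp, LinearMap.comp_id]
  refine ⟨e, fun g x => ?_⟩
  obtain ⟨a, ha⟩ := Submodule.Quotient.mk_surjective _ (e x)
  rw [he g x _ a rfl ha.symm, ← ha]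
  rfl
end

section
/- Let ℓ be an odd prime and m = 2^a · ℓ^b · c with a ∈ {0, 1}, b ≥ 0, and c a positive integer coprime to 2ℓ; let c₁ be the radical of c, i.e. the product of the distinct primes dividing c. Let Ω be an algebraic closure of ℚ_ℓ and ζ ∈ Ω a primitive m-th root of unity. Then there exists a ℚ_ℓ-algebra automorphism σ of Ω with σ(ζ) = ζ⁻¹ if and only if there exists a natural number r ≥ 1 such that c₁ divides ℓ^r + 1. -/
open Polynomial IsLocalRing
open scoped NNReal

theorem exists_eq_pow_of_aeval_minpoly_eq_zero {p : ℕ} [Fact p.Prime] {k : Type*} [Field k]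
    [Algebra (ZMod p) k] {x y : k} (hx : IsIntegral (ZMod p) x)
    (hy : aeval y (minpoly (ZMod p) x) = 0) : ∃ i : ℕ, y = x ^ p ^ i := by
  have hyi : IsIntegral (ZMod p) y := ⟨_, minpoly.monic hx, hy⟩
  let A := IntermediateField.adjoin (ZMod p) {x, y}
  have : FiniteDimensional (ZMod p) A := by
    refine IntermediateField.finiteDimensional_adjoin fun z hz ↦ ?_
    rcases hz with rfl | rfl
    exacts [hx, hyi]
  have : Finite A := Module.finite_of_finite (ZMod p)
  let x' : A := ⟨x, IntermediateField.subset_adjoin _ _ (by simp)⟩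
  let y' : A := ⟨y, IntermediateField.subset_adjoin _ _ (by simp)⟩
  have hconj : IsConjRoot (ZMod p) y' x' := by
    rw [IsConjRoot.comm, isConjRoot_def, IntermediateField.minpoly_eq,
      IntermediateField.minpoly_eq]
    exact isConjRoot_of_aeval_eq_zero hx hy
  obtain ⟨σ, hσ⟩ := isConjRoot_iff_exists_algEquiv.1 hconj
  obtain ⟨i, hi⟩ := FiniteField.exists_forall_apply_eq_pow (ZMod p) p A σ
  refine ⟨i, ?_⟩
  have := congrArg Subtype.val (hσ.symm.trans (hi x'))
  simpa using this
section Residue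

variable {p : ℕ} [Fact p.Prime] {Ω : Type*} [Field Ω] [Algebra ℚ_[p] Ω]

/-- A valuation on an algebraic extension of `ℚ_[p]` which extends the `p`-adic norm and is
invariant under all automorphisms. -/
theorem exists_galois_invariant_valuation (p : ℕ) [Fact p.Prime] (Ω : Type*) [Field Ω]
    [Algebra ℚ_[p] Ω] [Algebra.IsAlgebraic ℚ_[p] Ω] :
    ∃ v : Valuation Ω ℝ≥0, (∀ x : ℚ_[p], v (algebraMap ℚ_[p] Ω x) = ‖x‖₊) ∧
      ∀ (σ : Ω ≃ₐ[ℚ_[p]] Ω) (x : Ω), v (σ x) = v x := by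
  refine ⟨
    { toFun := fun x ↦ ⟨spectralNorm ℚ_[p] Ω x, spectralNorm_nonneg x⟩
      map_zero' := ?_
      map_one' := ?_
      map_mul' := fun x y ↦ ?_
      map_add_le_max' := fun x y ↦ ?_ }, fun x ↦ ?_, fun σ x ↦ ?_⟩
  · exact NNReal.eq spectralNorm_zero
  · exact NNReal.eq spectralNorm_one
  · exact NNReal.eq (spectralAlgNorm_mul x y)
  · exact_mod_cast isNonarchimedean_spectralNorm (K := ℚ_[p]) (L := Ω) x y
  · exact NNReal.eq (spectralNorm_extends x)
  · exact NNReal.eq (spectralNorm_eq_of_equiv σ x).symm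

variable (Ω) in
/-- The structure map of the ring `ℤ_[p]` into a field extension of `ℚ_[p]`. -/
noncomputable def padicIntHom : ℤ_[p] →+* Ω :=
  (algebraMap ℚ_[p] Ω).comp PadicInt.Coe.ringHom

theorem Valuation.residue_eq_zero_iff (v : Valuation Ω ℝ≥0) (x : v.valuationSubring) :
    residue v.valuationSubring x = 0 ↔ v (x : Ω) < 1 := by
  have hv : v.Integers v.valuationSubring :=
    ⟨Subtype.val_injective, fun x ↦ x.2, fun x h ↦ ⟨⟨x, h⟩, rfl⟩⟩
  rw [IsLocalRing.residue_eq_zero_iff, mem_maximalIdeal, mem_nonunits_iff,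
    hv.isUnit_iff_valuation_eq_one]
  exact ⟨fun h ↦ lt_of_le_of_ne x.2 h, fun h ↦ h.ne⟩

/-- The minimal polynomial of a root of unity has `p`-adic integer coefficients. -/
theorem exists_map_eq_minpoly (p : ℕ) [Fact p.Prime] {Ω : Type*} [Field Ω] [Algebra ℚ_[p] Ω]
    {C : ℕ} (hC : C ≠ 0) {x : Ω} (hx : x ^ C = 1) :
    ∃ P : ℤ_[p][X], P.map PadicInt.Coe.ringHom = minpoly ℚ_[p] x := by
  have hint : IsIntegral ℚ_[p] x := .of_pow (Nat.pos_of_ne_zero hC) (hx ▸ isIntegral_one)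
  obtain ⟨P, hP⟩ := IsIntegrallyClosed.eq_map_mul_C_of_dvd (R := ℤ_[p]) ℚ_[p]
    (f := X ^ C - 1) (monic_X_pow_sub_C 1 hC) (g := minpoly ℚ_[p] x)
    (minpoly.dvd _ _ (by simp [hx]))
  rw [(minpoly.monic hint).leadingCoeff, C_1, mul_one] at hP
  exact ⟨P, hP⟩

theorem Valuation.eq_one_of_pow_eq_one (v : Valuation Ω ℝ≥0) {C : ℕ} (hC : C ≠ 0) {x : Ω}
    (hx : x ^ C = 1) : v x = 1 := by
  rw [← pow_eq_one_iff_of_nonneg zero_le hC, ← map_pow, hx, map_one]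

theorem map_eval₂_padicIntHom (σ : Ω ≃ₐ[ℚ_[p]] Ω) (Q : ℤ_[p][X]) (x : Ω) :
    σ (Q.eval₂ (padicIntHom Ω) x) = Q.eval₂ (padicIntHom Ω) (σ x) := by
  simp [eval₂_eq_sum_range, padicIntHom]

variable {v : Valuation Ω ℝ≥0} (hv : ∀ x : ℚ_[p], v (algebraMap ℚ_[p] Ω x) = ‖x‖₊)
include hv

theorem padicIntHom_mem (a : ℤ_[p]) : padicIntHom Ω a ∈ v.valuationSubring := by
  rw [Valuation.mem_valuationSubring_iff]
  exact (hv a).trans_le a.norm_le_one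

/-- Reduction of `p`-adic integers in the residue field of an extension of `ℚ_[p]`. -/
noncomputable def padicIntResidue : ℤ_[p] →+* ResidueField v.valuationSubring :=
  (residue v.valuationSubring).comp
    ((padicIntHom Ω).codRestrict v.valuationSubring.toSubring (padicIntHom_mem hv))

theorem padicIntResidue_eq_zero_iff (a : ℤ_[p]) : padicIntResidue hv a = 0 ↔ ‖a‖ < 1 := by
  refine (v.residue_eq_zero_iff _).trans ?_
  change v (algebraMap ℚ_[p] Ω a) < 1 ↔ _
  rw [hv]
  exact Iff.rfl

theorem eval₂_mem (x : v.valuationSubring) (Q : ℤ_[p][X]) :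
    Q.eval₂ (padicIntHom Ω) (x : Ω) ∈ v.valuationSubring := by
  rw [eval₂_eq_sum_range]
  exact sum_mem fun i _ ↦ mul_mem (padicIntHom_mem hv _) (pow_mem x.2 _)

theorem eval₂_residue_eq_zero_iff (x : v.valuationSubring) (Q : ℤ_[p][X]) :
    Q.eval₂ (padicIntResidue hv) (residue _ x) = 0 ↔
      v (Q.eval₂ (padicIntHom Ω) (x : Ω)) < 1 := by
  rw [padicIntResidue, ← hom_eval₂, v.residue_eq_zero_iff]
  have := hom_eval₂ Q ((padicIntHom Ω).codRestrict v.valuationSubring.toSubring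
    (padicIntHom_mem hv)) v.valuationSubring.subtype x
  rw [show ((eval₂ ((padicIntHom Ω).codRestrict v.valuationSubring.toSubring
    (padicIntHom_mem hv)) x Q : v.valuationSubring) : Ω) = _ from this]
  rfl

theorem charP_residueField : CharP (ResidueField v.valuationSubring) p where
  cast_eq_zero_iff n := by
    rw [← map_natCast (padicIntResidue hv), padicIntResidue_eq_zero_iff,
      PadicInt.norm_natCast_lt_one_iff]

theorem padicIntResidue_pow (a : ℤ_[p]) : padicIntResidue hv a ^ p = padicIntResidue hv a := by
  rw [← sub_eq_zero, ← map_pow, ← map_sub, padicIntResidue_eq_zero_iff, ← PadicInt.mem_nonunits,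
    ← mem_maximalIdeal, ← PadicInt.ker_toZMod, RingHom.mem_ker, map_sub, map_pow, ZMod.pow_card,
    sub_self]

theorem eval₂_residue_pow (x : ResidueField v.valuationSubring) (Q : ℤ_[p][X]) :
    Q.eval₂ (padicIntResidue hv) (x ^ p) = Q.eval₂ (padicIntResidue hv) x ^ p := by
  have := charP_residueField hv
  have hφ : (frobenius (ResidueField v.valuationSubring) p).comp (padicIntResidue hv) =
      padicIntResidue hv := RingHom.ext (padicIntResidue_pow hv)
  have := hom_eval₂ Q (padicIntResidue hv) (frobenius (ResidueField v.valuationSubring) p) x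
  rw [hφ] at this
  exact this.symm

theorem eq_of_v_sub_lt_one {C : ℕ} (hC : p.Coprime C) {x y : Ω} (hx : x ^ C = 1) (hy : y ^ C = 1)
    (h : v (x - y) < 1) : x = y := by
  have hvC : v (C : Ω) = 1 := by
    rw [← map_natCast (algebraMap ℚ_[p] Ω), hv]
    exact NNReal.eq (Padic.norm_natCast_eq_one_iff.2 hC)
  have hC0 : C ≠ 0 := by
    rintro rfl
    simp at hvC
  have hy0 : y ≠ 0 := by
    rintro rfl
    simp [hC0] at hy
  set z := x / y with hz
  have hzC : z ^ C = 1 := by rw [hz, div_pow, hx, hy, div_one]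
  have hz1 : v (z - 1) < 1 := by
    rwa [hz, div_sub_one hy0, map_div₀, v.eq_one_of_pow_eq_one hC0 hy, div_one]
  by_contra hne
  have hz_ne : z - 1 ≠ 0 := by
    rw [sub_ne_zero, hz, ne_eq, div_eq_one_iff_eq hy0]
    exact hne
  have hsum : ∑ i ∈ Finset.range C, z ^ i = 0 := by
    have := geom_sum_mul z C
    rw [hzC, sub_self] at this
    exact (mul_eq_zero.1 this).resolve_right hz_ne
  have hlt : v (∑ i ∈ Finset.range C, (1 - z ^ i)) < 1 := by
    refine v.map_sum_lt one_ne_zero fun i _ ↦ ?_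
    rw [v.map_sub_swap, ← geom_sum_mul, map_mul]
    refine mul_lt_one_of_nonneg_of_lt_one_right (v.map_sum_le fun j _ ↦ ?_) zero_le hz1
    rw [map_pow, v.eq_one_of_pow_eq_one hC0 hzC, one_pow]
  rw [Finset.sum_sub_distrib, hsum, sub_zero, Finset.sum_const, Finset.card_range, nsmul_one,
    hvC] at hlt
  exact hlt.false

theorem isConjRoot_pow {C : ℕ} (hC : p.Coprime C) {x : Ω} (hx : x ^ C = 1) [IsAlgClosed Ω] :
    IsConjRoot ℚ_[p] x (x ^ p) := by
  have hC0 : C ≠ 0 := by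
    rintro rfl
    exact (Fact.out : p.Prime).one_lt.ne' ((Nat.coprime_zero_right p).1 hC)
  have hint : IsIntegral ℚ_[p] x := .of_pow (Nat.pos_of_ne_zero hC0) (hx ▸ isIntegral_one)
  obtain ⟨P, hP⟩ := exists_map_eq_minpoly p hC0 hx
  have heval (y : Ω) : P.eval₂ (padicIntHom Ω) y = aeval y (minpoly ℚ_[p] x) := by
    rw [← hP, aeval_def, eval₂_map, padicIntHom]
  have hxp : (x ^ p) ^ C = 1 := by rw [pow_right_comm, hx, one_pow]
  let ξ : v.valuationSubring := ⟨x, (v.eq_one_of_pow_eq_one hC0 hx).le⟩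
  have hlt : v (aeval (x ^ p) (minpoly ℚ_[p] x)) < 1 := by
    rw [← heval]
    refine (eval₂_residue_eq_zero_iff hv (ξ ^ p) P).1 ?_
    rw [map_pow, eval₂_residue_pow, (eval₂_residue_eq_zero_iff hv ξ P).2, zero_pow]
    · exact (Fact.out : p.Prime).ne_zero
    · rw [heval, minpoly.aeval, map_zero]
      exact one_pos
  have hsplit := IsAlgClosed.splits ((minpoly ℚ_[p] x).map (algebraMap ℚ_[p] Ω))
  rw [aeval_def, ← eval_map, hsplit.eval_eq_prod_roots_of_monic ((minpoly.monic hint).map _),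
    map_multiset_prod, Multiset.map_map] at hlt
  obtain ⟨y, hy, hylt⟩ : ∃ y ∈ ((minpoly ℚ_[p] x).map (algebraMap ℚ_[p] Ω)).roots,
      v (x ^ p - y) < 1 := by
    by_contra! hcon
    refine hlt.not_ge (Multiset.one_le_prod_of_one_le fun r hr ↦ ?_)
    obtain ⟨y, hy, rfl⟩ := Multiset.mem_map.1 hr
    exact hcon y hy
  have hy0 : aeval y (minpoly ℚ_[p] x) = 0 := by
    rw [aeval_def, ← eval_map]
    exact (mem_roots'.1 hy).2
  have hyC : y ^ C = 1 := by
    have : aeval y (X ^ C - 1 : ℚ_[p][X]) = 0 :=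
      aeval_eq_zero_of_dvd_aeval_eq_zero (minpoly.dvd _ _ (by simp [hx])) hy0
    simpa [sub_eq_zero] using this
  rw [eq_of_v_sub_lt_one hv hC hxp hyC hylt]
  exact isConjRoot_of_aeval_eq_zero hint hy0

theorem v_eval₂_eq_one [IsAlgClosure ℚ_[p] Ω]
    (hσ : ∀ (σ : Ω ≃ₐ[ℚ_[p]] Ω) (x : Ω), v (σ x) = v x)
    {C : ℕ} (hC : p.Coprime C) {x : Ω} (hx : x ^ C = 1) {Q : ℤ_[p][X]}
    (hQ : Q.natDegree < (minpoly ℚ_[p] x).natDegree) {i : ℕ} (hi : ‖Q.coeff i‖ = 1) :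
    v (Q.eval₂ (padicIntHom Ω) x) = 1 := by
  have hC0 : C ≠ 0 := by
    rintro rfl
    exact (Fact.out : p.Prime).one_lt.ne' ((Nat.coprime_zero_right p).1 hC)
  have : IsAlgClosed Ω := IsAlgClosure.isAlgClosed ℚ_[p]
  have : Algebra.IsAlgebraic ℚ_[p] Ω := IsAlgClosure.isAlgebraic
  have hnormal : Normal ℚ_[p] Ω := IsAlgClosure.normal ℚ_[p] Ω
  have hint : IsIntegral ℚ_[p] x := .of_pow (Nat.pos_of_ne_zero hC0) (hx ▸ isIntegral_one)
  have hroot (y : (minpoly ℚ_[p] x).rootSet Ω) : ∃ σ : Ω ≃ₐ[ℚ_[p]] Ω, σ x = y := by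
    have hy := isConjRoot_of_aeval_eq_zero hint (mem_rootSet'.1 y.2).2
    obtain ⟨σ, hσy⟩ := isConjRoot_iff_exists_algEquiv.1 hy.symm
    exact ⟨σ, hσy⟩
  have hrootC (y : (minpoly ℚ_[p] x).rootSet Ω) : (y : Ω) ^ C = 1 := by
    obtain ⟨σ, hσy⟩ := hroot y
    rw [← hσy, ← map_pow, hx, map_one]
  let r (y : (minpoly ℚ_[p] x).rootSet Ω) : v.valuationSubring :=
    ⟨y, (v.eq_one_of_pow_eq_one hC0 (hrootC y)).le⟩
  refine le_antisymm (eval₂_mem hv ⟨x, (v.eq_one_of_pow_eq_one hC0 hx).le⟩ Q) ?_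
  by_contra! hlt
  have hzero : Q.map (padicIntResidue hv) = 0 := by
    refine eq_zero_of_natDegree_lt_card_of_eval_eq_zero _ (f := fun y ↦ residue _ (r y))
      (fun y z hyz ↦ ?_) (fun y ↦ ?_) ?_
    · rw [← sub_eq_zero, ← map_sub, v.residue_eq_zero_iff] at hyz
      exact Subtype.ext (eq_of_v_sub_lt_one hv hC (hrootC y) (hrootC z) hyz)
    · rw [eval_map, eval₂_residue_eq_zero_iff]
      obtain ⟨σ, hσy⟩ := hroot y
      change v (eval₂ (padicIntHom Ω) (y : Ω) Q) < 1
      rwa [← hσy, ← map_eval₂_padicIntHom, hσ]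
    · rw [card_rootSet_eq_natDegree (minpoly.irreducible hint).separable
        (IsAlgClosed.splits _)]
      exact natDegree_map_le.trans_lt hQ
  have hci : padicIntResidue hv (Q.coeff i) = 0 := by
    rw [← coeff_map, hzero, coeff_zero]
  rw [padicIntResidue_eq_zero_iff, hi] at hci
  exact hci.false

theorem exists_v_eq_zpow [IsAlgClosure ℚ_[p] Ω]
    (hσ : ∀ (σ : Ω ≃ₐ[ℚ_[p]] Ω) (x : Ω), v (σ x) = v x)
    {C : ℕ} (hC : p.Coprime C) {x : Ω} (hx : x ^ C = 1) {y : Ω}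
    (hy : y ∈ IntermediateField.adjoin ℚ_[p] {x}) (hy0 : y ≠ 0) :
    ∃ n : ℤ, v y = (p : ℝ≥0) ^ n := by
  have hC0 : C ≠ 0 := by
    rintro rfl
    exact (Fact.out : p.Prime).one_lt.ne' ((Nat.coprime_zero_right p).1 hC)
  have hint : IsIntegral ℚ_[p] x := .of_pow (Nat.pos_of_ne_zero hC0) (hx ▸ isIntegral_one)
  obtain ⟨Q, hQdeg, hQ⟩ :
      ∃ Q : ℚ_[p][X], Q.natDegree < (minpoly ℚ_[p] x).natDegree ∧ y = aeval x Q := by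
    obtain ⟨Q, hQdeg, hQ⟩ :=
      (IntermediateField.adjoin.powerBasis hint).exists_eq_aeval ⟨y, hy⟩
    refine ⟨Q, hQdeg, ?_⟩
    have := congrArg (algebraMap _ Ω) hQ
    rw [← aeval_algebraMap_apply] at this
    exact this
  have hQ0 : Q ≠ 0 := by
    rintro rfl
    exact hy0 (by simpa using hQ)
  obtain ⟨i, hi, hmax⟩ := Q.support.exists_max_image (fun i ↦ ‖Q.coeff i‖)
    (nonempty_support_iff.2 hQ0)
  have hle (j : ℕ) : ‖Q.coeff j‖ ≤ ‖Q.coeff i‖ := by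
    by_cases hj : j ∈ Q.support
    · exact hmax j hj
    · rw [notMem_support_iff.1 hj, norm_zero]
      exact norm_nonneg _
  set a := Q.coeff i with ha_def
  have ha : a ≠ 0 := mem_support_iff.1 hi
  obtain ⟨R, hR⟩ : ∃ R : ℤ_[p][X], R.map PadicInt.Coe.ringHom = Polynomial.C a⁻¹ * Q := by
    rw [← mem_lifts, lifts_iff_coeff_lifts]
    intro j
    refine ⟨⟨(Polynomial.C a⁻¹ * Q).coeff j, ?_⟩, rfl⟩
    rw [coeff_C_mul, norm_mul, norm_inv, inv_mul_le_one₀ (norm_pos_iff.2 ha)]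
    exact hle j
  have hRdeg : R.natDegree = Q.natDegree := by
    rw [← natDegree_map_eq_of_injective Subtype.val_injective R (f := PadicInt.Coe.ringHom), hR,
      natDegree_C_mul (inv_ne_zero ha)]
  have hRi : ‖R.coeff i‖ = 1 := by
    have : PadicInt.Coe.ringHom (R.coeff i) = 1 := by
      rw [← coeff_map, hR, coeff_C_mul, ← ha_def, inv_mul_cancel₀ ha]
    rw [PadicInt.norm_def, show ((R.coeff i : ℤ_[p]) : ℚ_[p]) = 1 from this, norm_one]
  have hone := v_eval₂_eq_one hv hσ hC hx (hRdeg.trans_lt hQdeg) hRi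
  rw [padicIntHom, ← eval₂_map, hR, eval₂_mul, eval₂_C, map_mul, ← aeval_def, ← hQ, map_inv₀,
    map_inv₀, hv, inv_mul_eq_one₀ (nnnorm_ne_zero_iff.2 ha)] at hone
  refine ⟨-a.valuation, ?_⟩
  rw [← hone]
  exact NNReal.eq (by simp [Padic.norm_eq_zpow_neg_valuation ha])

theorem exists_eq_pow_of_algEquiv
    (hσ : ∀ (σ : Ω ≃ₐ[ℚ_[p]] Ω) (x : Ω), v (σ x) = v x)
    {C : ℕ} (hC : p.Coprime C) {x : Ω} (hx : x ^ C = 1) (σ : Ω ≃ₐ[ℚ_[p]] Ω) :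
    ∃ i : ℕ, σ x = x ^ p ^ i := by
  have hC0 : C ≠ 0 := by
    rintro rfl
    exact (Fact.out : p.Prime).one_lt.ne' ((Nat.coprime_zero_right p).1 hC)
  have hσx : σ x ^ C = 1 := by rw [← map_pow, hx, map_one]
  let ξ : v.valuationSubring := ⟨x, (v.eq_one_of_pow_eq_one hC0 hx).le⟩
  let η : v.valuationSubring := ⟨σ x, (v.eq_one_of_pow_eq_one hC0 hσx).le⟩
  have := charP_residueField hv
  let := ZMod.algebra (ResidueField v.valuationSubring) p
  have hφ : (algebraMap (ZMod p) (ResidueField v.valuationSubring)).comp PadicInt.toZMod =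
      padicIntResidue hv := by
    refine RingHom.ext fun a ↦ ?_
    have ha : padicIntResidue hv (a - (PadicInt.toZMod a).val) = 0 := by
      rw [padicIntResidue_eq_zero_iff, ← PadicInt.mem_nonunits, ← mem_maximalIdeal,
        ← PadicInt.ker_toZMod, RingHom.mem_ker, map_sub, map_natCast, ZMod.natCast_zmod_val,
        sub_self]
    rw [map_sub, map_natCast, sub_eq_zero] at ha
    rw [ha, RingHom.comp_apply, ← map_natCast (algebraMap (ZMod p) _), ZMod.natCast_zmod_val]
  have hξC : residue _ ξ ^ C = 1 := by
    rw [← map_pow, show ξ ^ C = 1 from Subtype.ext hx, map_one]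
  obtain ⟨Q, hQ⟩ := map_surjective PadicInt.toZMod (ZMod.ringHom_surjective _)
    (minpoly (ZMod p) (residue _ ξ))
  have heval (z : ResidueField v.valuationSubring) :
      aeval z (minpoly (ZMod p) (residue _ ξ)) = Q.eval₂ (padicIntResidue hv) z := by
    rw [← hQ, aeval_def, eval₂_map, hφ]
  have hη : aeval (residue _ η) (minpoly (ZMod p) (residue _ ξ)) = 0 := by
    rw [heval, eval₂_residue_eq_zero_iff]
    change v (eval₂ _ (σ x) Q) < 1
    rw [← map_eval₂_padicIntHom, hσ]
    refine (eval₂_residue_eq_zero_iff hv ξ Q).1 ?_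
    rw [← heval, minpoly.aeval]
  obtain ⟨i, hi⟩ := exists_eq_pow_of_aeval_minpoly_eq_zero
    (.of_pow (Nat.pos_of_ne_zero hC0) (hξC ▸ isIntegral_one)) hη
  refine ⟨i, eq_of_v_sub_lt_one hv hC hσx (by rw [pow_right_comm, hx, one_pow]) ?_⟩
  refine (v.residue_eq_zero_iff (η - ξ ^ p ^ i)).1 ?_
  rw [map_sub, map_pow, hi, sub_self]

/-- A primitive `p ^ b`-th root of unity has full degree over an extension of `ℚ_[p]` which is
unramified. -/
theorem minpoly_eq_cyclotomic_of_unramified [IsAlgClosed Ω] (K : IntermediateField ℚ_[p] Ω)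
    (hK : ∀ y ∈ K, y ≠ 0 → ∃ n : ℤ, v y = (p : ℝ≥0) ^ n)
    {b : ℕ} {ξ : Ω} (hξ : IsPrimitiveRoot ξ (p ^ (b + 1))) :
    minpoly K ξ = cyclotomic (p ^ (b + 1)) K := by
  have hp : p.Prime := Fact.out
  have hpos : 0 < p ^ (b + 1) := pow_pos hp.pos _
  have hint : IsIntegral K ξ := .of_pow hpos (hξ.pow_eq_one ▸ isIntegral_one)
  have hcyc {y : Ω} (hy : eval y (cyclotomic (p ^ (b + 1)) Ω) = 0) :
      IsPrimitiveRoot y (p ^ (b + 1)) := by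
    have : NeZero (((p ^ (b + 1) : ℕ)) : Ω) := by
      have := charZero_of_injective_algebraMap (algebraMap ℚ_[p] Ω).injective
      exact ⟨Nat.cast_ne_zero.2 hpos.ne'⟩
    exact isRoot_cyclotomic_iff.1 hy
  have hdvd : minpoly K ξ ∣ cyclotomic (p ^ (b + 1)) K := by
    refine minpoly.dvd _ _ ?_
    rw [aeval_def, ← eval_map, map_cyclotomic]
    exact hξ.isRoot_cyclotomic hpos
  have hle {y z : Ω} (hy : IsPrimitiveRoot y (p ^ (b + 1))) (hz : IsPrimitiveRoot z (p ^ (b + 1))) :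
      v (1 - z) ≤ v (1 - y) := by
    obtain ⟨i, -, rfl⟩ := hy.eq_pow_of_pow_eq_one hz.pow_eq_one
    rw [← mul_neg_geom_sum, map_mul]
    refine mul_le_of_le_one_right zero_le (v.map_sum_le fun j _ ↦ ?_)
    rw [map_pow, v.eq_one_of_pow_eq_one hpos.ne' hy.pow_eq_one, one_pow]
  have hprod {P : Polynomial Ω} (hP : P.Monic) (hPd : P ∣ cyclotomic (p ^ (b + 1)) Ω) :
      v (eval 1 P) = v (1 - ξ) ^ P.natDegree := by
    have hs := IsAlgClosed.splits P
    rw [hs.eval_eq_prod_roots_of_monic hP, map_multiset_prod, Multiset.map_map,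
      hs.natDegree_eq_card_roots, ← Multiset.prod_replicate, ← Multiset.map_const']
    refine congrArg _ (Multiset.map_congr rfl fun y hy ↦ ?_)
    have hy' := hcyc (eval_eq_zero_of_dvd_of_eval_eq_zero hPd (mem_roots'.1 hy).2)
    exact le_antisymm (hle hξ hy') (hle hy' hξ)
  have hvp : v (p : Ω) = (p : ℝ≥0)⁻¹ := by
    rw [← map_natCast (algebraMap ℚ_[p] Ω), hv]
    exact NNReal.eq (by simp)
  have hp1 : (1 : ℝ≥0) < p := by exact_mod_cast hp.one_lt
  have hφ := hprod (cyclotomic.monic _ _) dvd_rfl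
  rw [eval_one_cyclotomic_prime_pow, hvp, natDegree_cyclotomic] at hφ
  have hN := hprod ((minpoly.monic hint).map (algebraMap K Ω))
    (by simpa using map_dvd (mapRingHom (algebraMap K Ω)) hdvd)
  rw [natDegree_map, eval_one_map] at hN
  set t := v (1 - ξ)
  have ht : t ≠ 0 := by
    intro h
    rw [h, zero_pow (Nat.totient_pos.2 hpos).ne', inv_eq_zero] at hφ
    exact (zero_lt_one.trans hp1).ne' hφ
  obtain ⟨n, hn⟩ := hK _ (eval 1 (minpoly K ξ)).2 (by
    intro h
    change (algebraMap K Ω) _ = 0 at h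
    rw [h, map_zero] at hN
    exact pow_ne_zero _ ht hN.symm)
  change v (algebraMap K Ω _) = _ at hn
  have hkey : (p : ℝ≥0) ^ (-((minpoly K ξ).natDegree : ℤ)) =
      (p : ℝ≥0) ^ (n * ((p ^ (b + 1)).totient : ℤ)) := by
    rw [zpow_neg, ← inv_zpow, hφ, zpow_mul, ← hn, hN]
    simp only [zpow_natCast]
    rw [pow_right_comm]
  have hexp := zpow_right_injective₀ (zero_lt_one.trans hp1) hp1.ne' hkey
  have hdiv : (p ^ (b + 1)).totient ∣ (minpoly K ξ).natDegree := by
    rw [← Int.natCast_dvd_natCast, ← dvd_neg, hexp]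
    exact dvd_mul_left _ _
  refine (eq_of_monic_of_dvd_of_natDegree_le (minpoly.monic hint) (cyclotomic.monic _ _) hdvd
    ?_).symm
  rw [natDegree_cyclotomic]
  exact Nat.le_of_dvd (minpoly.natDegree_pos hint) hdiv


end Residue

/-- Inversion on the roots of unity of order `p ^ b * C`, with `C` coprime to `p`, is induced by a
`ℚ_[p]`-automorphism exactly when `-1` is a power of `p` modulo `C`. -/
theorem exists_algEquiv_apply_eq_inv_iff {p : ℕ} [Fact p.Prime] {Ω : Type*} [Field Ω]
    [Algebra ℚ_[p] Ω] [IsAlgClosure ℚ_[p] Ω] {b C : ℕ} (hC : p.Coprime C) {ζ : Ω}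
    (hζ : IsPrimitiveRoot ζ (p ^ b * C)) :
    (∃ σ : Ω ≃ₐ[ℚ_[p]] Ω, σ ζ = ζ⁻¹) ↔ ∃ r : ℕ, C ∣ p ^ r + 1 := by
  have hp : p.Prime := Fact.out
  have hC0 : 0 < C := by
    refine Nat.pos_of_ne_zero ?_
    rintro rfl
    exact hp.one_lt.ne' ((Nat.coprime_zero_right p).1 hC)
  have : IsAlgClosed Ω := IsAlgClosure.isAlgClosed ℚ_[p]
  have : Algebra.IsAlgebraic ℚ_[p] Ω := IsAlgClosure.isAlgebraic
  have : Normal ℚ_[p] Ω := IsAlgClosure.normal ℚ_[p] Ω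
  have hm : 0 < p ^ b * C := Nat.mul_pos (pow_pos hp.pos b) hC0
  have hζ0 : ζ ≠ 0 := hζ.ne_zero hm.ne'
  obtain ⟨v, hv, hσv⟩ := exists_galois_invariant_valuation p Ω
  have hη : IsPrimitiveRoot (ζ ^ p ^ b) C := hζ.pow hm rfl
  have hξ : IsPrimitiveRoot (ζ ^ C) (p ^ b) := hζ.pow hm (mul_comm _ _)
  set η := ζ ^ p ^ b with hη_def
  set ξ := ζ ^ C with hξ_def
  have hη0 : η ≠ 0 := pow_ne_zero _ hζ0
  have hinv (r : ℕ) : η ^ p ^ r = η⁻¹ ↔ C ∣ p ^ r + 1 := by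
    rw [← hη.pow_eq_one_iff_dvd, pow_succ, ← mul_eq_one_iff_eq_inv₀ hη0]
  constructor
  · rintro ⟨σ, hσ⟩
    obtain ⟨r, hr⟩ := exists_eq_pow_of_algEquiv hv hσv hC hη.pow_eq_one σ
    refine ⟨r, (hinv r).1 ?_⟩
    rw [← hr, hη_def, map_pow, hσ, inv_pow]
  · rintro ⟨r, hr⟩
    obtain ⟨φ, hφ⟩ := isConjRoot_iff_exists_algEquiv.1
      (isConjRoot_pow hv hC hη.pow_eq_one).symm
    have hφr (n : ℕ) : (φ ^ n) η = η ^ p ^ n := by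
      induction n with
      | zero => simp
      | succ n ih => rw [pow_succ', AlgEquiv.mul_apply, ih, map_pow, hφ, ← pow_mul, pow_succ']
    let K := IntermediateField.adjoin ℚ_[p] {η}
    obtain ⟨τ, hτ⟩ : ∃ τ : Ω ≃ₐ[K] Ω, τ ((φ ^ r) ξ) = ξ⁻¹ := by
      cases b with
      | zero =>
        have hξ1 : ξ = 1 := by simpa using hξ.pow_eq_one
        exact ⟨AlgEquiv.refl, by simp [hξ1]⟩
      | succ b =>
        have hK (y : Ω) (hy : y ∈ K) (hy0 : y ≠ 0) : ∃ n : ℤ, v y = (p : ℝ≥0) ^ n :=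
          exists_v_eq_zpow hv hσv hC hη.pow_eq_one hy hy0
        refine isConjRoot_iff_exists_algEquiv.1 ?_
        rw [isConjRoot_def, minpoly_eq_cyclotomic_of_unramified hv K hK hξ.inv,
          minpoly_eq_cyclotomic_of_unramified hv K hK
            (hξ.map_of_injective (φ ^ r).injective)]
    let σ : Ω ≃ₐ[ℚ_[p]] Ω := τ.restrictScalars ℚ_[p] * φ ^ r
    have hση : σ η = η⁻¹ := by
      change τ ((φ ^ r) η) = _
      rw [hφr, (hinv r).2 hr]
      exact τ.commutes (⟨η, IntermediateField.mem_adjoin_simple_self _ _⟩⁻¹ : K)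
    have hσξ : σ ξ = ξ⁻¹ := hτ
    refine ⟨σ, eq_inv_of_mul_eq_one_left ?_⟩
    have h1 : (σ ζ * ζ) ^ p ^ b = 1 := by
      rw [mul_pow, ← map_pow, ← hη_def, hση, inv_mul_cancel₀ hη0]
    have h2 : (σ ζ * ζ) ^ C = 1 := by
      rw [mul_pow, ← map_pow, ← hξ_def, hσξ, inv_mul_cancel₀ (pow_ne_zero _ hζ0)]
    have := pow_gcd_eq_one.2 ⟨h1, h2⟩
    rwa [(hC.pow_left b).gcd_eq_one, pow_one] at this

/-- If the radical of an odd number `c` divides `n ^ r + 1`, then `c` divides some `n ^ s + 1`. -/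
theorem exists_dvd_pow_add_one_of_radical_dvd {n r c : ℕ} (hc : Odd c)
    (h : ∏ q ∈ c.primeFactors, q ∣ n ^ r + 1) : ∃ s : ℕ, c ∣ n ^ s + 1 := by
  set d := ∏ q ∈ c.primeFactors, q with hd_def
  have hc0 : c ≠ 0 := hc.pos.ne'
  have hd : d ∣ c := Nat.prod_primeFactors_dvd c
  have hpow (k : ℕ) : d ^ (k + 1) ∣ n ^ (r * d ^ k) + 1 := by
    have := dvd_sub_pow_of_dvd_sub (R := ℤ) (p := d) (a := (n : ℤ) ^ r) (b := -1)
      (by rw [sub_neg_eq_add]; exact_mod_cast h) k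
    rw [((hc.of_dvd_nat hd).pow).neg_one_pow, sub_neg_eq_add, ← pow_mul] at this
    exact_mod_cast this
  exact ⟨_, (Nat.dvd_prod_primeFactors_pow_self hc0).trans
    ((pow_dvd_pow d c.le_succ).trans (hpow c))⟩

/-- case (i) of Proposition 4.3.  For an odd prime `ℓ` and
`m = 2^a · ℓ^b · c` with `a ≤ 1` and `c` coprime to `2ℓ`, a primitive `m`-th root
of unity `ζ` in an algebraic closure `Ω` of `ℚ_ℓ` is conjugate to `ζ⁻¹` over `ℚ_ℓ`
iff `c₁ ∣ ℓ^r + 1` for some `r ≥ 1`, where `c₁` is the radical of `c`. -/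
theorem stmt4 (ℓ : ℕ) [Fact ℓ.Prime] (hℓ : ℓ ≠ 2)
    (a b c m : ℕ) (ha : a ≤ 1) (hc : 0 < c) (hcop : Nat.Coprime c (2 * ℓ))
    (hm : m = 2 ^ a * ℓ ^ b * c)
    (c₁ : ℕ) (hc₁ : c₁ = ∏ p ∈ c.primeFactors, p)
    (Ω : Type*) [Field Ω] [Algebra ℚ_[ℓ] Ω] [IsAlgClosure ℚ_[ℓ] Ω]
    (ζ : Ω) (hζ : IsPrimitiveRoot ζ m) :
    (∃ σ : Ω ≃ₐ[ℚ_[ℓ]] Ω, σ ζ = ζ⁻¹) ↔ ∃ r : ℕ, 1 ≤ r ∧ c₁ ∣ ℓ ^ r + 1 := by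
  have hp : ℓ.Prime := Fact.out
  have hodd : Odd ℓ := hp.odd_of_ne_two hℓ
  have hc2 : Nat.Coprime c 2 := hcop.coprime_mul_right_right
  have hcℓ : Nat.Coprime c ℓ := hcop.coprime_mul_left_right
  have hcodd : Odd c := Nat.coprime_two_right.1 hc2
  have hC : ℓ.Coprime (2 ^ a * c) :=
    .mul_right (.pow_right _ (Nat.coprime_two_right.2 hodd)) hcℓ.symm
  have heven (r : ℕ) : 2 ∣ ℓ ^ r + 1 := (hodd.pow.add_odd odd_one).two_dvd
  rw [hm, show 2 ^ a * ℓ ^ b * c = ℓ ^ b * (2 ^ a * c) by ring] at hζ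
  rw [exists_algEquiv_apply_eq_inv_iff hC hζ, hc₁]
  constructor
  · rintro ⟨r, hr⟩
    have hdvd : ∏ p ∈ c.primeFactors, p ∣ ℓ ^ r + 1 :=
      (Nat.prod_primeFactors_dvd c).trans ((dvd_mul_left _ _).trans hr)
    rcases Nat.eq_zero_or_pos r with rfl | hr0
    · refine ⟨1, le_rfl, ?_⟩
      rw [pow_zero] at hdvd
      exact hdvd.trans (heven 1)
    · exact ⟨r, hr0, hdvd⟩
  · rintro ⟨r, -, hr⟩
    obtain ⟨s, hs⟩ := exists_dvd_pow_add_one_of_radical_dvd hcodd hr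
    exact ⟨s, (hc2.symm.pow_left a).mul_dvd_of_dvd_of_dvd
      ((pow_dvd_pow 2 ha).trans (by simpa using heven s)) hs⟩
end

section
/- Let ℓ be an odd prime and m = 2^a · ℓ^b · c with a ≥ 2, b ≥ 0, and c a positive integer coprime to 2ℓ; let c₁ be the radical of c, i.e. the product of the distinct primes dividing c. Let Ω be an algebraic closure of ℚ_ℓ and ζ ∈ Ω a primitive m-th root of unity. Then there exists a ℚ_ℓ-algebra automorphism σ of Ω with σ(ζ) = ζ⁻¹ if and only if ℓ ≡ 3 (mod 4) and there exists an odd natural number r with 2^a · c₁ dividing ℓ^r + 1. -/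
open Polynomial IsLocalRing

/-- The integral closure of `ℤ_[p]` in an algebraic extension of `ℚ_[p]` is the unit ball of the
spectral norm. -/
theorem PadicInt.isIntegral_iff_spectralNorm_le_one {p : ℕ} [Fact p.Prime] {L : Type*} [Field L]
    [Algebra ℚ_[p] L] [Algebra.IsAlgebraic ℚ_[p] L] [Algebra ℤ_[p] L]
    [IsScalarTower ℤ_[p] ℚ_[p] L] (x : L) :
    IsIntegral ℤ_[p] x ↔ spectralNorm ℚ_[p] L x ≤ 1 := by
  have hx : IsIntegral ℚ_[p] x := Algebra.IsIntegral.isIntegral x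
  rw [spectralNorm, spectralValue_le_one_iff (minpoly.monic hx)]
  constructor
  · intro h n
    rw [minpoly.isIntegrallyClosed_eq_field_fractions' ℚ_[p] h, coeff_map]
    exact PadicInt.norm_le_one _
  · intro h
    have hlift : minpoly ℚ_[p] x ∈ lifts (algebraMap ℤ_[p] ℚ_[p]) :=
      (lifts_iff_coeff_lifts _).2 fun n ↦ ⟨⟨_, h n⟩, rfl⟩
    obtain ⟨q, hq, -, hmonic⟩ := lifts_and_degree_eq_and_monic hlift (minpoly.monic hx)
    refine ⟨q, hmonic, ?_⟩
    rw [← aeval_def, ← aeval_map_algebraMap ℚ_[p], hq, minpoly.aeval]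

instance PadicInt.isLocalRing_integralClosure {p : ℕ} [Fact p.Prime] {L : Type*} [Field L]
    [Algebra ℚ_[p] L] [Algebra.IsAlgebraic ℚ_[p] L] [Algebra ℤ_[p] L]
    [IsScalarTower ℤ_[p] ℚ_[p] L] : IsLocalRing (integralClosure ℤ_[p] L) := by
  have isUnit_of_norm (x : integralClosure ℤ_[p] L) (hx : spectralNorm ℚ_[p] L (x : L) = 1) :
      IsUnit x := by
    have hx0 : (x : L) ≠ 0 := by
      rintro h
      simp [h, spectralNorm_zero] at hx
    have hinv : spectralNorm ℚ_[p] L (x : L)⁻¹ ≤ 1 := by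
      have h := map_mul (spectralMulAlgNorm ℚ_[p] L) (x : L) (x : L)⁻¹
      rw [mul_inv_cancel₀ hx0, map_one, spectralMulAlgNorm_def, spectralMulAlgNorm_def, hx,
        one_mul] at h
      exact h.ge
    refine IsUnit.of_mul_eq_one
      ⟨(x : L)⁻¹, (PadicInt.isIntegral_iff_spectralNorm_le_one _).2 hinv⟩ (Subtype.ext ?_)
    exact mul_inv_cancel₀ hx0
  have norm_lt (x : integralClosure ℤ_[p] L) (hx : x ∈ nonunits (integralClosure ℤ_[p] L)) :
      spectralNorm ℚ_[p] L (x : L) < 1 :=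
    lt_of_le_of_ne ((PadicInt.isIntegral_iff_spectralNorm_le_one _).1 x.2)
      fun h ↦ hx (isUnit_of_norm x h)
  refine IsLocalRing.of_nonunits_add fun x y hx hy hxy ↦ ?_
  obtain ⟨z, hz⟩ := hxy.exists_right_inv
  have hlt : spectralNorm ℚ_[p] L ((x : L) + y) < 1 :=
    (isNonarchimedean_spectralNorm (x : L) y).trans_lt (max_lt (norm_lt x hx) (norm_lt y hy))
  have hz1 := (PadicInt.isIntegral_iff_spectralNorm_le_one (z : L)).1 z.2
  have h := map_mul (spectralMulAlgNorm ℚ_[p] L) ((x : L) + y) z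
  have hxyz : ((x : L) + y) * z = 1 := congrArg Subtype.val hz
  rw [hxyz, map_one, spectralMulAlgNorm_def, spectralMulAlgNorm_def] at h
  exact (mul_lt_one_of_nonneg_of_lt_one_left (spectralNorm_nonneg _) hlt hz1).ne' h

theorem FiniteField.exists_ringEquiv_eq_pow {k : Type*} [Field k] [Finite k] (p : ℕ)
    [Fact p.Prime] [CharP k p] (τ : k ≃+* k) : ∃ i : ℕ, ∀ x, τ x = x ^ p ^ i := by
  let _ := ZMod.algebra k p
  obtain ⟨i, hi⟩ := (bijective_frobeniusAlgEquivOfAlgebraic_pow (ZMod p) k).2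
    (AlgEquiv.ofRingEquiv (f := τ) fun x ↦ DFunLike.congr_fun
      (Subsingleton.elim ((τ : k →+* k).comp (algebraMap (ZMod p) k)) (algebraMap (ZMod p) k)) x)
  refine ⟨i, fun x ↦ ?_⟩
  have := DFunLike.congr_fun hi x
  rw [AlgEquiv.coe_pow, coe_frobeniusAlgEquivOfAlgebraic_iterate, ZMod.card] at this
  exact this.symm

theorem PadicInt.isLocalHom_algebraMap (p : ℕ) [Fact p.Prime] (B : Type*) [CommRing B]
    [Algebra ℤ_[p] B] [Module.Finite ℤ_[p] B] [FaithfulSMul ℤ_[p] B] :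
    IsLocalHom (algebraMap ℤ_[p] B) :=
  RingHom.IsIntegral.isLocalHom Algebra.IsIntegral.isIntegral
    (FaithfulSMul.algebraMap_injective _ _)

theorem PadicInt.charP_residueField (p : ℕ) [Fact p.Prime] (B : Type*) [CommRing B]
    [IsLocalRing B] [Algebra ℤ_[p] B] [IsLocalHom (algebraMap ℤ_[p] B)] :
    CharP (ResidueField B) p := by
  refine (CharP.charP_iff_prime_eq_zero Fact.out).2 ?_
  have h := (Ideal.mem_of_liesOver (maximalIdeal B) (maximalIdeal ℤ_[p]) (p : ℤ_[p])).1
    PadicInt.p_nonunit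
  rw [map_natCast] at h
  rw [← map_natCast (residue B), residue_eq_zero_iff]
  exact h

theorem PadicInt.finite_residueField (p : ℕ) [Fact p.Prime] (B : Type*) [CommRing B]
    [IsLocalRing B] [Algebra ℤ_[p] B] [IsLocalHom (algebraMap ℤ_[p] B)] [Module.Finite ℤ_[p] B] :
    Finite (ResidueField B) := by
  have : Finite (ResidueField ℤ_[p]) := Finite.of_equiv _ PadicInt.residueField.symm.toEquiv
  exact Module.finite_of_finite (ResidueField ℤ_[p])

theorem IsPrimitiveRoot.pow_eq_pow_iff_modEq {M : Type*} [CommMonoid M] {n : ℕ} [NeZero n] {ζ : M}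
    (hζ : IsPrimitiveRoot ζ n) {i j : ℕ} : ζ ^ i = ζ ^ j ↔ i ≡ j [MOD n] := by
  rw [(hζ.isOfFinOrder (NeZero.ne n)).pow_eq_pow_iff_modEq, ← hζ.eq_orderOf]

/-- Reduction to the residue field preserves the order of roots of unity of order prime to the
residue characteristic. -/
theorem IsPrimitiveRoot.map_residue {B : Type*} [CommRing B] [IsDomain B] [IsLocalRing B] {p n : ℕ}
    [CharP (ResidueField B) p] (hp : p.Prime) (hpn : p.Coprime n) {ζ : B}
    (hζ : IsPrimitiveRoot ζ n) : IsPrimitiveRoot (residue B ζ) n := by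
  have hn : NeZero (n : ResidueField B) :=
    ⟨fun h ↦ (hp.coprime_iff_not_dvd.1 hpn) ((CharP.cast_eq_zero_iff _ p n).1 h)⟩
  have hn' : NeZero (n : B) := ⟨fun h ↦ hn.out (by rw [← map_natCast (residue B), h, map_zero])⟩
  rw [← isRoot_cyclotomic_iff, ← map_cyclotomic n (residue B)]
  exact (isRoot_cyclotomic_iff.2 hζ).map

theorem PadicInt.orderOf_le_inertiaDeg {p : ℕ} [Fact p.Prime] {B : Type*} [CommRing B] [IsDomain B]
    [IsLocalRing B] [Algebra ℤ_[p] B] [Module.Finite ℤ_[p] B] [FaithfulSMul ℤ_[p] B] {n : ℕ}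
    [NeZero n] (hpn : p.Coprime n) {ζ : B} (hζ : IsPrimitiveRoot ζ n) :
    orderOf (ZMod.unitOfCoprime p hpn) ≤ (maximalIdeal B).inertiaDeg ℤ_[p] := by
  have := PadicInt.isLocalHom_algebraMap p B
  have := PadicInt.charP_residueField p B
  have := PadicInt.finite_residueField p B
  have hcard : Nat.card (ResidueField B) = p ^ (maximalIdeal B).inertiaDeg ℤ_[p] := by
    have h := Ideal.cardQuot_pow_inertiaDeg (maximalIdeal ℤ_[p]) (maximalIdeal B)
    have hp : (maximalIdeal ℤ_[p]).cardQuot = p := by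
      rw [Submodule.cardQuot_apply]
      exact (Nat.card_congr PadicInt.residueField.toEquiv).trans (Nat.card_zmod p)
    rw [hp] at h
    exact h.symm
  refine orderOf_le_of_pow_eq_one (Ideal.inertiaDeg_pos _ _) (Units.ext ?_)
  have hζ' := hζ.map_residue (Fact.out : p.Prime) hpn
  have h1 : residue B ζ ^ (p ^ (maximalIdeal B).inertiaDeg ℤ_[p]) = residue B ζ ^ 1 := by
    let _ := Fintype.ofFinite (ResidueField B)
    rw [← hcard, Nat.card_eq_fintype_card, FiniteField.pow_card, pow_one]
  have hmod := hζ'.pow_eq_pow_iff_modEq.1 h1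
  rw [← ZMod.natCast_eq_natCast_iff] at hmod
  simpa using hmod

theorem PadicInt.totient_le_ramificationIdx {p : ℕ} [Fact p.Prime] {B : Type*} [CommRing B]
    [IsDedekindDomain B] [IsLocalRing B] [Algebra ℤ_[p] B] [Module.Finite ℤ_[p] B]
    [FaithfulSMul ℤ_[p] B] {b : ℕ} {ζ : B} (hζ : IsPrimitiveRoot ζ (p ^ b)) :
    (p ^ b).totient ≤ (maximalIdeal B).ramificationIdx ℤ_[p] := by
  have := PadicInt.isLocalHom_algebraMap p B
  have := PadicInt.charP_residueField p B
  obtain _ | b := b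
  · simpa [Nat.one_le_iff_ne_zero, Nat.pos_iff_ne_zero] using
      Ideal.ramificationIdx_pos (maximalIdeal B) ℤ_[p]
  have hmap : (maximalIdeal ℤ_[p]).map (algebraMap ℤ_[p] B) = Ideal.span {(p : B)} := by
    rw [PadicInt.maximalIdeal_eq_span_p, Ideal.map_span, Set.image_singleton, map_natCast]
  have hp0 : (p : B) ≠ 0 := by
    rw [← map_natCast (algebraMap ℤ_[p] B)]
    exact (map_ne_zero_iff _ (FaithfulSMul.algebraMap_injective _ _)).2 PadicInt.prime_p.ne_zero
  have hne : (maximalIdeal ℤ_[p]).map (algebraMap ℤ_[p] B) ≠ ⊥ := by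
    rw [hmap]
    simpa using hp0
  have hle : Ideal.span {(p : B)} ≤ maximalIdeal B ^ (p ^ (b + 1)).totient := by
    rw [Ideal.span_singleton_le_iff_mem, ← eval_one_cyclotomic_prime_pow b,
      cyclotomic_eq_prod_X_sub_primitiveRoots hζ, eval_prod, ← hζ.card_primitiveRoots,
      ← Finset.prod_const]
    refine Ideal.prod_mem_prod fun μ hμ ↦ ?_
    have hμ1 : residue B μ = 1 := by
      have h : residue B μ ^ p ^ (b + 1) = 1 := by
        rw [← map_pow, (isPrimitiveRoot_of_mem_primitiveRoots hμ).pow_eq_one, map_one]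
      simpa using (ExpChar.pow_prime_pow_mul_eq_one_iff p (b + 1) 1 (residue B μ)).1
        (by simpa using h)
    rw [← residue_eq_zero_iff]
    simp [hμ1]
  rw [Ideal.IsDedekindDomain.ramificationIdx_eq_multiplicity (maximalIdeal ℤ_[p]) (maximalIdeal B)
    hne, hmap]
  refine FiniteMultiplicity.le_multiplicity_of_pow_dvd ?_ (Ideal.dvd_iff_le.2 hle)
  have hbot : maximalIdeal B ≠ ⊥ := by
    rintro h
    have hpos : 0 < (p ^ (b + 1)).totient := Nat.totient_pos.2 (pow_pos (Fact.out : p.Prime).pos _)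
    rw [h, ← Ideal.zero_eq_bot, zero_pow hpos.ne'] at hle
    simp [hp0] at hle
  refine FiniteMultiplicity.of_not_isUnit ?_ (by simpa using hp0)
  rw [Ideal.isUnit_iff]
  exact Ideal.IsPrime.ne_top'

theorem PadicInt.ramificationIdx_mul_inertiaDeg (p : ℕ) [Fact p.Prime] (B : Type*) [CommRing B]
    [IsDedekindDomain B] [IsLocalRing B] [Algebra ℤ_[p] B] [Module.Finite ℤ_[p] B]
    [FaithfulSMul ℤ_[p] B] :
    (maximalIdeal B).ramificationIdx ℤ_[p] * (maximalIdeal B).inertiaDeg ℤ_[p] =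
      Module.finrank ℤ_[p] B := by
  have hprimes : (maximalIdeal ℤ_[p]).primesOver B = {maximalIdeal B} :=
    IsLocalRing.primesOver_eq B (IsDiscreteValuationRing.not_a_field _)
  let _ : Unique ((maximalIdeal ℤ_[p]).primesOver B) := by
    rw [hprimes]
    infer_instance
  rw [← Ideal.sum_ramification_inertia_eq_finrank (maximalIdeal ℤ_[p]) B, Fintype.sum_unique]
  have h : (default : (maximalIdeal ℤ_[p]).primesOver B).1 = maximalIdeal B := by
    exact hprimes.le (default : (maximalIdeal ℤ_[p]).primesOver B).2
  rw [h]

theorem card_comap_unitsMap_zpowers {p m n b : ℕ} [NeZero m] [NeZero n]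
    (hm : m = n * p ^ b) (hpn : p.Coprime n) (hnm : n ∣ m) :
    Nat.card ((Subgroup.zpowers (ZMod.unitOfCoprime p hpn)).comap (ZMod.unitsMap hnm)) =
      (p ^ b).totient * orderOf (ZMod.unitOfCoprime p hpn) := by
  set H := Subgroup.zpowers (ZMod.unitOfCoprime p hpn)
  have htot : m.totient = n.totient * (p ^ b).totient := by
    rw [hm, Nat.totient_mul (hpn.symm.pow_right b)]
  have h1 := (H.comap (ZMod.unitsMap hnm)).card_mul_index
  have h2 := H.card_mul_index
  rw [Subgroup.index_comap_of_surjective _ (ZMod.unitsMap_surjective hnm),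
    Nat.card_eq_fintype_card (α := (ZMod m)ˣ), ZMod.card_units_eq_totient, htot] at h1
  rw [Nat.card_eq_fintype_card (α := (ZMod n)ˣ), ZMod.card_units_eq_totient,
    Nat.card_zpowers] at h2
  have h0 : 0 < H.index := Nat.pos_of_ne_zero H.index_ne_zero_of_finite
  refine Nat.eq_of_mul_eq_mul_right h0 ?_
  rw [h1, ← h2]
  ring

/-- The image of `Gal(ℚ_p(ζ_m)/ℚ_p)` in `(ℤ/m)ˣ`, for `m = n * p ^ b` with `p ∤ n`, consists of the
units whose reduction modulo `n` is a power of `p`. -/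
theorem IsPrimitiveRoot.range_autToPow_padic {p : ℕ} [Fact p.Prime] {L : Type*} [Field L]
    [Algebra ℚ_[p] L] [Algebra ℤ_[p] L] [IsScalarTower ℤ_[p] ℚ_[p] L] {m n b : ℕ} [NeZero m]
    [NeZero n] [IsCyclotomicExtension {m} ℚ_[p] L] (hm : m = n * p ^ b) (hpn : p.Coprime n)
    (hnm : n ∣ m) {ζ : L} (hζ : IsPrimitiveRoot ζ m) :
    (hζ.autToPow ℚ_[p]).range =
      (Subgroup.zpowers (ZMod.unitOfCoprime p hpn)).comap (ZMod.unitsMap hnm) := by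
  have hp : p.Prime := Fact.out
  have : FiniteDimensional ℚ_[p] L := IsCyclotomicExtension.finiteDimensional {m} ℚ_[p] L
  have : IsGalois ℚ_[p] L := IsCyclotomicExtension.isGalois {m} ℚ_[p] L
  let B := integralClosure ℤ_[p] L
  have : IsFractionRing B L := integralClosure.isFractionRing_of_finite_extension ℚ_[p] L
  have : IsDedekindDomain B := integralClosure.isDedekindDomain ℤ_[p] ℚ_[p] L
  have : Module.Finite ℤ_[p] B := IsIntegralClosure.finite ℤ_[p] ℚ_[p] L B
  have : FaithfulSMul ℤ_[p] L := by
    rw [faithfulSMul_iff_algebraMap_injective, IsScalarTower.algebraMap_eq ℤ_[p] ℚ_[p] L]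
    exact (algebraMap ℚ_[p] L).injective.comp (IsFractionRing.injective _ _)
  have : FaithfulSMul ℤ_[p] B := inferInstance
  have := PadicInt.isLocalHom_algebraMap p B
  have := PadicInt.charP_residueField p B
  have := PadicInt.finite_residueField p B
  let z : B := ⟨ζ, (hζ.isIntegral (NeZero.pos m)).tower_top⟩
  have hz : IsPrimitiveRoot z m :=
    IsPrimitiveRoot.of_map_of_injective (f := algebraMap B L) hζ Subtype.val_injective
  have hzn : IsPrimitiveRoot (z ^ p ^ b) n := hz.pow (NeZero.pos m) (by rw [hm, mul_comm])
  refine Subgroup.eq_of_le_of_card_ge ?_ ?_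
  · rintro _ ⟨σ, rfl⟩
    set u := hζ.autToPow ℚ_[p] σ
    let σB := galRestrict ℤ_[p] ℚ_[p] L B σ
    have hσ : σB z = z ^ (u : ZMod m).val := by
      apply Subtype.val_injective
      exact (algebraMap_galRestrict_apply ℤ_[p] σ z).trans (hζ.autToPow_spec ℚ_[p] σ).symm
    obtain ⟨i, hi⟩ := FiniteField.exists_ringEquiv_eq_pow p (ResidueField.mapEquiv σB.toRingEquiv)
    have hres : residue B (z ^ p ^ b) ^ (u : ZMod m).val = residue B (z ^ p ^ b) ^ p ^ i := by
      rw [← hi]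
      change _ = residue B (σB (z ^ p ^ b))
      rw [map_pow σB, hσ, ← map_pow, ← pow_mul, ← pow_mul, mul_comm]
    have hmod := (hzn.map_residue hp hpn).pow_eq_pow_iff_modEq.1 hres
    rw [← ZMod.natCast_eq_natCast_iff, ZMod.natCast_val] at hmod
    refine ⟨i, Units.ext ?_⟩
    simpa [ZMod.unitsMap_val] using hmod.symm
  · have hcard : Nat.card (hζ.autToPow ℚ_[p]).range =
        (maximalIdeal B).ramificationIdx ℤ_[p] * (maximalIdeal B).inertiaDeg ℤ_[p] := by
      rw [PadicInt.ramificationIdx_mul_inertiaDeg, ← IsFractionRing.finrank_eq ℤ_[p] ℚ_[p] B L,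
        ← IsGalois.card_aut_eq_finrank]
      exact (Nat.card_congr
        (MonoidHom.ofInjective (hζ.autToPow_injective ℚ_[p])).toEquiv).symm
    rw [hcard, card_comap_unitsMap_zpowers hm hpn]
    exact Nat.mul_le_mul (PadicInt.totient_le_ramificationIdx (hz.pow (NeZero.pos m) hm))
      (PadicInt.orderOf_le_inertiaDeg hpn hzn)

/-- A primitive `n * p ^ b`-th root of unity with `p ∤ n` is conjugate to its inverse over `ℚ_p`
if and only if `-1` is a power of `p` modulo `n`. -/
theorem IsPrimitiveRoot.exists_algEquiv_padic_eq_inv_iff {p : ℕ} [Fact p.Prime] {Ω : Type*}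
    [Field Ω] [Algebra ℚ_[p] Ω] [Normal ℚ_[p] Ω] {n b : ℕ} [NeZero n]
    (hpn : p.Coprime n) {ζ : Ω} (hζ : IsPrimitiveRoot ζ (n * p ^ b)) :
    (∃ σ : Ω ≃ₐ[ℚ_[p]] Ω, σ ζ = ζ⁻¹) ↔ ∃ r : ℕ, n ∣ p ^ r + 1 := by
  have hp : p.Prime := Fact.out
  have : NeZero p := ⟨hp.ne_zero⟩
  set m := n * p ^ b with hm
  have : NeZero m := ⟨mul_ne_zero (NeZero.ne n) (pow_ne_zero b hp.ne_zero)⟩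
  have hnm : n ∣ m := Dvd.intro _ rfl
  let L := IntermediateField.adjoin ℚ_[p] {ζ}
  let _ : Algebra ℤ_[p] L := ((algebraMap ℚ_[p] L).comp (algebraMap ℤ_[p] ℚ_[p])).toAlgebra
  have : IsScalarTower ℤ_[p] ℚ_[p] L := IsScalarTower.of_algebraMap_eq' rfl
  have : IsCyclotomicExtension {m} ℚ_[p] L :=
    hζ.intermediateField_adjoin_isCyclotomicExtension ℚ_[p]
  have : IsGalois ℚ_[p] L := IsCyclotomicExtension.isGalois {m} ℚ_[p] L
  let z : L := ⟨ζ, IntermediateField.mem_adjoin_simple_self ℚ_[p] ζ⟩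
  have hz : IsPrimitiveRoot z m :=
    IsPrimitiveRoot.of_map_of_injective (f := algebraMap L Ω) hζ (algebraMap L Ω).injective
  have hL : (∃ σ : Ω ≃ₐ[ℚ_[p]] Ω, σ ζ = ζ⁻¹) ↔ ∃ τ : L ≃ₐ[ℚ_[p]] L, τ z = z⁻¹ := by
    constructor
    · rintro ⟨σ, hσ⟩
      exact ⟨σ.restrictNormal L, Subtype.val_injective ((σ.restrictNormal_commutes L z).trans hσ)⟩
    · rintro ⟨τ, hτ⟩
      refine ⟨τ.liftNormal Ω, (τ.liftNormal_commutes Ω z).trans ?_⟩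
      rw [hτ]
      rfl
  have hneg : (∃ τ : L ≃ₐ[ℚ_[p]] L, τ z = z⁻¹) ↔ -1 ∈ (hz.autToPow ℚ_[p]).range := by
    refine exists_congr fun τ ↦ ?_
    rw [← hz.autToPow_spec ℚ_[p] τ, ← mul_eq_one_iff_eq_inv₀ (hz.ne_zero (NeZero.ne m)), ← pow_succ,
      hz.pow_eq_one_iff_dvd, ← ZMod.natCast_eq_zero_iff, Units.ext_iff]
    simp [eq_neg_iff_add_eq_zero]
  have hmap : ZMod.unitsMap hnm (-1) = -1 := Units.ext (by rw [ZMod.unitsMap_def]; simp)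
  rw [hL, hneg, hz.range_autToPow_padic hm hpn hnm, Subgroup.mem_comap, hmap,
    ← mem_powers_iff_mem_zpowers]
  refine exists_congr fun r ↦ ?_
  rw [← ZMod.natCast_eq_zero_iff, Units.ext_iff]
  simp [eq_neg_iff_add_eq_zero]

/-- If every prime factor of the odd number `c` divides `x + 1`, then `c` divides `x ^ c + 1`. -/
theorem Nat.dvd_pow_self_add_one {x c : ℕ} (hc : Odd c)
    (h : ∀ p, p.Prime → p ∣ c → p ∣ x + 1) : c ∣ x ^ c + 1 := by
  refine (Nat.dvd_iff_prime_pow_dvd_dvd _ _).2 fun p k hp hk ↦ ?_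
  obtain _ | k := k
  · simp
  have hpc : p ∣ c := (dvd_pow_self p k.succ_ne_zero).trans hk
  have hodd : Odd (p ^ (k + 1)) := hc.of_dvd_nat hk
  have hsub : (p : ℤ) ∣ (x : ℤ) - (-1) := by
    rw [sub_neg_eq_add]
    exact_mod_cast h p hp hpc
  have hdvd := dvd_sub_pow_of_dvd_sub hsub (k + 1)
  rw [hodd.neg_one_pow, sub_neg_eq_add] at hdvd
  obtain ⟨d, rfl⟩ := hk
  have hd : Odd d := (Nat.odd_mul.1 hc).2
  have hstep : x ^ p ^ (k + 1) + 1 ∣ x ^ (p ^ (k + 1) * d) + 1 := by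
    simpa [pow_mul] using hd.nat_add_dvd_pow_add_pow (x ^ p ^ (k + 1)) 1
  refine Dvd.dvd.trans ?_ hstep
  exact (pow_dvd_pow p (k + 1).le_succ).trans (by exact_mod_cast hdvd)

theorem Nat.odd_and_mod_four_of_four_dvd_pow_add_one {x r : ℕ} (h : 4 ∣ x ^ r + 1) :
    Odd r ∧ x % 4 = 3 := by
  have hx : x % 4 < 4 := Nat.mod_lt _ (by decide)
  have hmod : (x % 4) ^ r % 4 = 3 := by
    rw [← Nat.pow_mod]
    omega
  obtain ⟨k, rfl | rfl⟩ := Nat.even_or_odd' r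
  · exfalso
    rw [pow_mul, Nat.pow_mod] at hmod
    generalize x % 4 = y at *
    interval_cases y <;> rcases k.eq_zero_or_pos with rfl | hk <;> simp_all
  · refine ⟨odd_two_mul_add_one k, ?_⟩
    rw [pow_succ, pow_mul, Nat.mul_mod, Nat.pow_mod] at hmod
    generalize x % 4 = y at *
    interval_cases y <;> rcases k.eq_zero_or_pos with rfl | hk <;> simp_all

/-- For `a ≥ 2` and odd `c`, `-1` is a power of `x` modulo `2 ^ a * c` if and only if `x` is
`3` modulo `4` and `-1` is an odd power of `x` modulo `2 ^ a * rad c`. -/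
theorem Nat.exists_two_pow_mul_dvd_pow_add_one_iff {x a c : ℕ} (ha : 2 ≤ a) (hc : Odd c) :
    (∃ r, 2 ^ a * c ∣ x ^ r + 1) ↔
      x % 4 = 3 ∧ ∃ r, Odd r ∧ 2 ^ a * ∏ p ∈ c.primeFactors, p ∣ x ^ r + 1 := by
  constructor
  · rintro ⟨r, hr⟩
    have h4 : 4 ∣ x ^ r + 1 := ((pow_dvd_pow 2 ha).trans (Dvd.intro _ rfl)).trans hr
    obtain ⟨hodd, hmod⟩ := Nat.odd_and_mod_four_of_four_dvd_pow_add_one h4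
    exact ⟨hmod, r, hodd, (mul_dvd_mul_left _ c.prod_primeFactors_dvd).trans hr⟩
  · rintro ⟨-, r, -, hr⟩
    have hpow : x ^ r + 1 ∣ x ^ (r * c) + 1 := by
      simpa [pow_mul] using hc.nat_add_dvd_pow_add_pow (x ^ r) 1
    have hcop : (2 ^ a).Coprime c := (Nat.coprime_two_left.2 hc).pow_left a
    refine ⟨r * c, hcop.mul_dvd_of_dvd_of_dvd
      ((dvd_of_mul_right_dvd hr).trans hpow) ?_⟩
    rw [pow_mul]
    refine Nat.dvd_pow_self_add_one hc fun p hp hpc ↦ ?_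
    exact (Finset.dvd_prod_of_mem _ (Nat.mem_primeFactors.2 ⟨hp, hpc, hc.pos.ne'⟩)).trans
      (dvd_of_mul_left_dvd hr)

/-- case (ii) of Proposition 4.3.  For an odd prime `ℓ` and
`m = 2^a · ℓ^b · c` with `a ≥ 2` and `c` coprime to `2ℓ`, a primitive `m`-th root
of unity `ζ` in an algebraic closure `Ω` of `ℚ_ℓ` is conjugate to `ζ⁻¹` over `ℚ_ℓ`
iff `ℓ ≡ 3 (mod 4)` and `2^a · c₁ ∣ ℓ^r + 1` for some odd `r`, where `c₁` is the
radical of `c`. -/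
theorem stmt5 (ℓ : ℕ) [Fact ℓ.Prime] (hℓ : ℓ ≠ 2)
    (a b c m : ℕ) (ha : 2 ≤ a) (hc : 0 < c) (hcop : Nat.Coprime c (2 * ℓ))
    (hm : m = 2 ^ a * ℓ ^ b * c)
    (c₁ : ℕ) (hc₁ : c₁ = ∏ p ∈ c.primeFactors, p)
    (Ω : Type*) [Field Ω] [Algebra ℚ_[ℓ] Ω] [IsAlgClosure ℚ_[ℓ] Ω]
    (ζ : Ω) (hζ : IsPrimitiveRoot ζ m) :
    (∃ σ : Ω ≃ₐ[ℚ_[ℓ]] Ω, σ ζ = ζ⁻¹) ↔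
      ℓ % 4 = 3 ∧ ∃ r : ℕ, Odd r ∧ 2 ^ a * c₁ ∣ ℓ ^ r + 1 := by
  have hodd : Odd c := Nat.coprime_two_right.1 (hcop.coprime_dvd_right (Dvd.intro _ rfl))
  have hcℓ : c.Coprime ℓ := hcop.coprime_dvd_right (Dvd.intro_left _ rfl)
  have h2ℓ : ℓ.Coprime 2 := (Nat.coprime_primes Fact.out Nat.prime_two).2 hℓ
  have hn : NeZero (2 ^ a * c) := ⟨by positivity⟩
  have : Normal ℚ_[ℓ] Ω := IsAlgClosure.normal ℚ_[ℓ] Ω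
  have hζ' : IsPrimitiveRoot ζ (2 ^ a * c * ℓ ^ b) := by
    rwa [mul_right_comm, ← hm]
  rw [hζ'.exists_algEquiv_padic_eq_inv_iff ((h2ℓ.pow_right a).mul_right hcℓ.symm), hc₁]
  exact Nat.exists_two_pow_mul_dvd_pow_add_one_iff ha hodd
end

section
/- Let ℓ = 2 and m = 2^a · c with a ≥ 0 and c an odd positive integer; let c₁ be the radical of c, i.e. the product of the distinct primes dividing c. Let Ω be an algebraic closure of ℚ₂ and ζ ∈ Ω a primitive m-th root of unity. Then there exists a ℚ₂-algebra automorphism σ of Ω with σ(ζ) = ζ⁻¹ if and only if there exists a natural number r ≥ 1 such that c₁ divides 2^r + 1. -/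
open Polynomial

/-- The integers of `Ω` have a residue domain of characteristic two whose kernel is Galois stable. -/
theorem exists_reduction_of_isAlgClosure (Ω : Type*) [Field Ω] [Algebra ℚ_[2] Ω]
    [Algebra.IsAlgebraic ℚ_[2] Ω] [Algebra ℤ_[2] Ω] [IsScalarTower ℤ_[2] ℚ_[2] Ω] :
    ∃ Q : Ideal (integralClosure ℤ_[2] Ω), Q.IsPrime ∧ (2 : integralClosure ℤ_[2] Ω) ∈ Q ∧
      ∀ (σ : Ω ≃ₐ[ℚ_[2]] Ω) (x y : integralClosure ℤ_[2] Ω), (y : Ω) = σ x → x ∈ Q → y ∈ Q := by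
  have hle (x : integralClosure ℤ_[2] Ω) : spectralNorm ℚ_[2] Ω x ≤ 1 := by
    have hx : IsIntegral ℤ_[2] (x : Ω) := x.2
    rw [spectralNorm, spectralValue_le_one_iff (minpoly.monic (Algebra.IsIntegral.isIntegral _)),
      minpoly.isIntegrallyClosed_eq_field_fractions' ℚ_[2] hx]
    intro n
    rw [coeff_map]
    exact PadicInt.norm_le_one _
  have hmul (x y : Ω) : spectralNorm ℚ_[2] Ω (x * y) =
      spectralNorm ℚ_[2] Ω x * spectralNorm ℚ_[2] Ω y :=
    map_mul (spectralMulAlgNorm ℚ_[2] Ω) x y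
  refine ⟨{ carrier := {x | spectralNorm ℚ_[2] Ω x < 1}
            add_mem' := fun {x y} hx hy ↦
              (isNonarchimedean_spectralNorm (x : Ω) (y : Ω)).trans_lt (max_lt hx hy)
            zero_mem' := by simp [spectralNorm_zero]
            smul_mem' := fun a x hx ↦ ?_ }, ⟨?_, fun {x y} hxy ↦ ?_⟩, ?_, fun σ x y h hx ↦ ?_⟩
  · change spectralNorm ℚ_[2] Ω ((a : Ω) * x) < 1
    rw [hmul]
    exact mul_lt_one_of_nonneg_of_lt_one_right (hle a) (spectralNorm_nonneg _) hx
  · rw [Ideal.ne_top_iff_one]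
    change ¬ spectralNorm ℚ_[2] Ω (1 : Ω) < 1
    simp [spectralNorm_one]
  · change spectralNorm ℚ_[2] Ω ((x : Ω) * y) < 1 at hxy
    change spectralNorm ℚ_[2] Ω x < 1 ∨ spectralNorm ℚ_[2] Ω y < 1
    by_contra! h
    rw [hmul, (hle x).antisymm h.1, (hle y).antisymm h.2] at hxy
    norm_num at hxy
  · change spectralNorm ℚ_[2] Ω (2 : Ω) < 1
    have := spectralNorm_extends (L := Ω) (2 : ℚ_[2])
    rw [map_ofNat] at this
    rw [this]
    exact_mod_cast Padic.norm_p_lt_one (p := 2)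
  · change spectralNorm ℚ_[2] Ω y < 1
    rw [h, ← spectralNorm_eq_of_equiv]
    exact hx

/-- A polynomial over a domain of characteristic two that is fixed by Frobenius lifts to `ℤ`. -/
theorem mem_lifts_intCast_of_map_frobenius_eq {k : Type*} [CommRing k] [IsDomain k] [CharP k 2]
    {h : k[X]} (hh : h.map (frobenius k 2) = h) : h ∈ lifts (Int.castRingHom k) := by
  rw [lifts_iff_coeff_lifts]
  intro n
  have h1 : h.coeff n ^ 2 = h.coeff n := by
    simpa [frobenius_def] using congrArg (coeff · n) hh
  have h2 : h.coeff n * (h.coeff n - 1) = 0 := by linear_combination h1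
  rcases mul_eq_zero.mp h2 with h | h
  · exact ⟨0, by simp [h]⟩
  · exact ⟨1, by simp [sub_eq_zero.mp h]⟩

/-- The Frobenius orbit of a periodic element is the zero set of an integer polynomial. -/
theorem exists_intPoly_frobenius_orbit {k : Type*} [CommRing k] [IsDomain k] [CharP k 2]
    {α : k} {d : ℕ} (hd : 0 < d) (hα : α ^ 2 ^ d = α) :
    ∃ H : ℤ[X], ∀ β : k, aeval β H = 0 ↔ ∃ i, β = α ^ 2 ^ i := by
  obtain ⟨H, hH⟩ := (mem_lifts _).mp (mem_lifts_intCast_of_map_frobenius_eq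
    (h := ∏ i ∈ Finset.range d, (X - C (α ^ 2 ^ i))) (by
      obtain ⟨e, rfl⟩ := Nat.exists_eq_add_of_lt hd
      simp only [zero_add] at hα ⊢
      rw [Polynomial.map_prod, Finset.prod_range_succ, Finset.prod_range_succ', mul_comm]
      simp only [Polynomial.map_sub, map_X, map_C, frobenius_def, ← pow_mul, ← pow_succ, hα,
        pow_zero, pow_one]
      rw [mul_comm]))
  have key (β : k) : aeval β H = 0 ↔ ∃ i ∈ Finset.range d, β = α ^ 2 ^ i := by
    rw [aeval_def, ← eval_map, show algebraMap ℤ k = Int.castRingHom k from rfl, hH, eval_prod,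
      Finset.prod_eq_zero_iff]
    simp [sub_eq_zero]
  refine ⟨H, fun β ↦ (key β).trans ⟨fun ⟨i, _, h⟩ ↦ ⟨i, h⟩, fun ⟨i, h⟩ ↦ ?_⟩⟩
  have hmul (n : ℕ) : α ^ 2 ^ (d * n) = α := by
    induction n with
    | zero => simp
    | succ n ih => rw [mul_add, mul_one, pow_add, pow_mul, ih, hα]
  refine ⟨i % d, Finset.mem_range.mpr (Nat.mod_lt _ hd), ?_⟩
  rw [h]
  conv_lhs => rw [← Nat.div_add_mod i d, pow_add, pow_mul, hmul]

/-- Roots of unity of odd order are determined by their reduction in characteristic two. -/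
theorem eq_of_pow_eq_one_of_map_eq {O k : Type*} [CommRing O] [IsDomain O] [CommRing k]
    [IsDomain k] [CharP k 2] (red : O →+* k) {c : ℕ} (hc : Odd c) {x y : O} (hx : x ^ c = 1)
    (hy : y ^ c = 1) (hxy : red x = red y) : x = y := by
  by_contra hne
  have h1 : (∑ i ∈ Finset.range c, x ^ i * y ^ (c - 1 - i)) * (x - y) = 0 := by
    rw [geom_sum₂_mul, hx, hy, sub_self]
  have h2 := (mul_eq_zero.mp h1).resolve_right (sub_ne_zero.mpr hne)
  have h3 := congrArg red h2
  have h4 : ∀ i ∈ Finset.range c, red y ^ i * red y ^ (c - 1 - i) = red y ^ (c - 1) := by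
    intro i hi
    rw [← pow_add]
    congr 1
    have := Finset.mem_range.mp hi
    lia
  simp only [map_sum, map_mul, map_pow, hxy, map_zero] at h3
  rw [Finset.sum_congr rfl h4, Finset.sum_const, Finset.card_range, nsmul_eq_mul] at h3
  rcases mul_eq_zero.mp h3 with h | h
  · rw [CharP.cast_eq_zero_iff k 2] at h
    exact (Nat.not_even_iff_odd.mpr hc) (even_iff_two_dvd.mpr h)
  · have h5 : red y ^ c = 1 := by rw [← map_pow, hy, map_one]
    rw [← Nat.sub_add_cancel hc.pos, pow_succ, h, zero_mul] at h5
    exact zero_ne_one h5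

theorem isEisensteinAt_cyclotomic_two_pow_comp (k : ℕ) :
    ((cyclotomic (2 ^ (k + 1)) ℤ_[2]).comp (X + 1)).IsEisensteinAt (Ideal.span {(2 : ℤ_[2])}) := by
  have hZ := cyclotomic_prime_pow_comp_X_add_one_isEisensteinAt 2 k
  have hmap : (cyclotomic (2 ^ (k + 1)) ℤ_[2]).comp (X + 1) =
      ((cyclotomic (2 ^ (k + 1)) ℤ).comp (X + 1)).map (Int.castRingHom ℤ_[2]) := by
    simp [Polynomial.map_comp]
  have hmonic : ((cyclotomic (2 ^ (k + 1)) ℤ).comp (X + 1)).Monic := by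
    rw [← C_1]; exact (cyclotomic.monic _ ℤ).comp_X_add_C 1
  have h2 : Prime (2 : ℤ_[2]) := by exact_mod_cast PadicInt.prime_p (p := 2)
  refine Monic.isEisensteinAt_of_mem_of_notMem (hmap ▸ hmonic.map _) ?_ (fun {n} hn ↦ ?_) ?_
  · exact ((Ideal.span_singleton_prime h2.ne_zero).mpr h2).ne_top
  · rw [hmap, hmonic.natDegree_map] at hn
    have := hZ.mem hn
    simp only [Nat.cast_ofNat, Ideal.submodule_span_eq, Ideal.mem_span_singleton] at this
    rw [hmap, coeff_map, Ideal.mem_span_singleton]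
    simpa using map_dvd (Int.castRingHom ℤ_[2]) this
  · rw [coeff_zero_eq_eval_zero, eval_comp, Ideal.span_singleton_pow, Ideal.mem_span_singleton]
    simp only [eval_add, eval_X, eval_one, zero_add, eval_one_cyclotomic_prime_pow, Nat.cast_ofNat]
    rintro ⟨a, ha⟩
    refine h2.not_isUnit (IsUnit.of_mul_eq_one a ?_)
    exact mul_left_cancel₀ h2.ne_zero (by linear_combination -ha)

theorem minpoly_sub_one_of_isPrimitiveRoot_two_pow {S : Type*} [CommRing S] [IsDomain S]
    [Algebra ℤ_[2] S] [Module.IsTorsionFree ℤ_[2] S] {ξ : S} {k : ℕ}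
    (hξ : IsPrimitiveRoot ξ (2 ^ (k + 1))) :
    minpoly ℤ_[2] (ξ - 1) = (cyclotomic (2 ^ (k + 1)) ℤ_[2]).comp (X + 1) := by
  have hmonic : ((cyclotomic (2 ^ (k + 1)) ℤ_[2]).comp (X + 1)).Monic := by
    rw [← C_1]; exact (cyclotomic.monic _ ℤ_[2]).comp_X_add_C 1
  have h2 : Prime (2 : ℤ_[2]) := by exact_mod_cast PadicInt.prime_p (p := 2)
  have heis := isEisensteinAt_cyclotomic_two_pow_comp k
  have hdeg : 0 < ((cyclotomic (2 ^ (k + 1)) ℤ_[2]).comp (X + 1)).natDegree := by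
    rw [natDegree_comp, ← C_1, natDegree_X_add_C, mul_one, natDegree_cyclotomic]
    exact Nat.totient_pos.mpr (by positivity)
  have hirr := heis.irreducible ((Ideal.span_singleton_prime h2.ne_zero).mpr h2)
    hmonic.isPrimitive hdeg
  have hint : IsIntegral ℤ_[2] (ξ - 1) :=
    (hξ.isIntegral (by positivity)).tower_top.sub isIntegral_one
  have hroot : aeval (ξ - 1) ((cyclotomic (2 ^ (k + 1)) ℤ_[2]).comp (X + 1)) = 0 := by
    rw [aeval_comp]
    simpa [aeval_def, ← eval_map] using hξ.isRoot_cyclotomic (by positivity)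
  refine eq_of_monic_of_associated (minpoly.monic hint) hmonic ?_
  exact (minpoly.irreducible hint).associated_of_dvd hirr
    (minpoly.isIntegrallyClosed_dvd hint hroot)

theorem exists_smul_two_pow_mem_adjoin {L : Type*} [Field L] [Algebra ℚ_[2] L] [Algebra ℤ_[2] L]
    [IsScalarTower ℤ_[2] ℚ_[2] L] {π z : L} (hz : z ∈ Algebra.adjoin ℚ_[2] {π}) :
    ∃ n : ℕ, (2 : ℤ_[2]) ^ n • z ∈ Algebra.adjoin ℤ_[2] {π} := by
  obtain ⟨q, rfl⟩ := Algebra.adjoin_singleton_eq_range_aeval ℚ_[2] π ▸ hz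
  obtain ⟨b, hb, hbq⟩ := IsLocalization.integerNormalization_spec (nonZeroDivisors ℤ_[2]) q
  have hb0 : b ≠ 0 := nonZeroDivisors.ne_zero hb
  refine ⟨b.valuation, ?_⟩
  have h1 : b • aeval π q ∈ Algebra.adjoin ℤ_[2] {π} := by
    have h := congrArg (aeval π) hbq
    rw [aeval_map_algebraMap, ← algebraMap_smul ℚ_[2] b q, map_smul, algebraMap_smul] at h
    rw [← h]
    exact aeval_mem_adjoin_singleton _ _
  have h2 : (2 : ℤ_[2]) ^ b.valuation = ((PadicInt.unitCoeff hb0)⁻¹ : ℤ_[2]ˣ) * b := by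
    rw [Units.eq_inv_mul_iff_mul_eq]
    exact (PadicInt.unitCoeff_spec hb0).symm
  rw [h2, mul_smul]
  exact Subalgebra.smul_mem _ h1 _

/-- The residues of integral elements of `ℚ₂(ξ)`, for `ξ` of order a power of two, come from `ℤ`. -/
theorem exists_int_eq_map_of_mem_adjoin_two_pow_root {Ω : Type*} [Field Ω] [Algebra ℚ_[2] Ω]
    [Algebra ℤ_[2] Ω] [IsScalarTower ℤ_[2] ℚ_[2] Ω] {k : Type*} [CommRing k] [IsDomain k]
    [CharP k 2] (red : integralClosure ℤ_[2] Ω →+* k) {ξ : Ω} {e : ℕ}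
    (hξ : IsPrimitiveRoot ξ (2 ^ (e + 1))) (x : integralClosure ℤ_[2] Ω)
    (hx : (x : Ω) ∈ IntermediateField.adjoin ℚ_[2] {ξ - 1}) : ∃ n : ℤ, red x = n := by
  have hξ_int : IsIntegral ℤ_[2] ξ := (hξ.isIntegral (by positivity)).tower_top
  have hπ : IsIntegral ℤ_[2] (ξ - 1) := hξ_int.sub isIntegral_one
  have hπK : IsIntegral ℚ_[2] (ξ - 1) := hπ.tower_top
  let L := IntermediateField.adjoin ℚ_[2] {ξ - 1}
  let B : PowerBasis ℚ_[2] L := IntermediateField.adjoin.powerBasis hπK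
  have hB : algebraMap L Ω B.gen = ξ - 1 := by simp [B, L]
  have : Module.IsTorsionFree ℤ_[2] Ω := Module.IsTorsionFree.trans_faithfulSMul ℤ_[2] ℚ_[2] Ω
  have : IsScalarTower ℤ_[2] L Ω := .of_algebraMap_eq fun _ ↦ rfl
  have hinj : Function.Injective (algebraMap L Ω) := (algebraMap L Ω).injective
  have hBint : IsIntegral ℤ_[2] B.gen := by
    rw [← isIntegral_algebraMap_iff hinj, hB]; exact hπ
  have hBmin : (minpoly ℤ_[2] B.gen).IsEisensteinAt (Ideal.span {(2 : ℤ_[2])}) := by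
    rw [← minpoly.algebraMap_eq hinj, hB, minpoly_sub_one_of_isPrimitiveRoot_two_pow hξ]
    exact isEisensteinAt_cyclotomic_two_pow_comp e
  let z : L := ⟨x, hx⟩
  have hzint : IsIntegral ℤ_[2] z := by
    rw [← isIntegral_algebraMap_iff hinj]; exact x.2
  obtain ⟨n, hn⟩ := exists_smul_two_pow_mem_adjoin (L := L) (π := B.gen) (z := z)
    (by rw [B.adjoin_gen_eq_top]; trivial)
  have hz := mem_adjoin_of_smul_prime_pow_smul_of_minpoly_isEisensteinAt (K := ℚ_[2])
    (by exact_mod_cast PadicInt.prime_p (p := 2)) hBint hzint hn hBmin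
  obtain ⟨g, hg⟩ := Algebra.adjoin_singleton_eq_range_aeval ℤ_[2] B.gen ▸ hz
  let ξ' : integralClosure ℤ_[2] Ω := ⟨ξ, hξ_int⟩
  have hgx : aeval (ξ' - 1) g = x := by
    apply Subtype.val_injective
    have h1 := congrArg (algebraMap L Ω) hg
    change algebraMap L Ω (aeval B.gen g) = x at h1
    rw [← aeval_algebraMap_apply, hB] at h1
    rw [← h1]
    exact (aeval_algebraMap_apply Ω (ξ' - 1) g).symm
  have hξ' : red (ξ' - 1) = 0 := by
    have h1 : ξ' ^ 2 ^ (e + 1) = 1 := Subtype.val_injective hξ.pow_eq_one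
    have h2 : (red ξ' - 1) ^ 2 ^ (e + 1) = 0 := by
      rw [sub_pow_char_pow, ← map_pow, h1]; simp
    rw [map_sub, map_one]
    exact eq_zero_of_pow_eq_zero h2
  have hcoeff : red x = red (algebraMap ℤ_[2] _ (g.coeff 0)) := by
    rw [← hgx, aeval_def, hom_eval₂, hξ', eval₂_at_zero]; rfl
  obtain ⟨n, -, hn⟩ := PadicInt.exists_mem_range (g.coeff 0)
  rw [PadicInt.maximalIdeal_eq_span_p, Ideal.mem_span_singleton] at hn
  obtain ⟨w, hw⟩ := hn
  refine ⟨n, ?_⟩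
  rw [hcoeff, sub_eq_iff_eq_add.mp hw]
  have h2 : red (algebraMap ℤ_[2] _ 2) = 0 := by
    rw [map_ofNat, map_ofNat, CharTwo.two_eq_zero]
  simp [h2]

/-- If the elements of `O ∩ L` reduce to integers, then `Gal(Ω/L)` realizes the squaring map on
roots of unity of odd order. -/
theorem exists_algEquiv_eq_sq {Ω : Type*} [Field Ω] [IsAlgClosed Ω] [Algebra ℚ_[2] Ω]
    [Algebra.IsAlgebraic ℚ_[2] Ω]
    [Algebra ℤ_[2] Ω] [IsScalarTower ℤ_[2] ℚ_[2] Ω] {k : Type*} [CommRing k] [IsDomain k]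
    [CharP k 2] (red : integralClosure ℤ_[2] Ω →+* k) (L : IntermediateField ℚ_[2] Ω)
    (hL : ∀ x : integralClosure ℤ_[2] Ω, (x : Ω) ∈ L → ∃ n : ℤ, red x = n)
    {c : ℕ} (hc : Odd c) {θ : Ω} (hθ : θ ^ c = 1) :
    ∃ τ : Ω ≃ₐ[L] Ω, τ θ = θ ^ 2 := by
  have hint {y : Ω} (hy : y ^ c = 1) : IsIntegral ℤ_[2] y :=
    .of_pow hc.pos (hy ▸ isIntegral_one)
  have : Algebra.IsAlgebraic L Ω := Algebra.IsAlgebraic.tower_top (K := ℚ_[2]) L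
  have : Normal L Ω := normal_iff.mpr fun x ↦
    ⟨Algebra.IsIntegral.isIntegral x, IsAlgClosed.splits _⟩
  set g := (minpoly L θ).map (algebraMap L Ω) with hg
  have hmonic : g.Monic := (minpoly.monic (Algebra.IsIntegral.isIntegral θ)).map _
  have hdvd : g ∣ X ^ c - 1 := by
    have := Polynomial.map_dvd (algebraMap L Ω) (minpoly.dvd L θ (p := X ^ c - 1) (by simp [hθ]))
    simpa using this
  obtain ⟨G, hG⟩ := (mem_lifts _).mp (integralClosure.mem_lifts_of_monic_of_dvd_map (R := ℤ_[2]) Ω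
    (f := X ^ c - 1) (monic_X_pow_sub_C 1 hc.pos.ne') hmonic (by simpa using hdvd))
  obtain ⟨Q, hQ⟩ := (mem_lifts _).mp (show G.map red ∈ lifts (Int.castRingHom k) by
    rw [lifts_iff_coeff_lifts]
    intro n
    obtain ⟨a, ha⟩ := hL (G.coeff n) (by
      have := congrArg (coeff · n) hG
      simp only [coeff_map, hg] at this
      change (G.coeff n : Ω) = _ at this
      rw [this]
      exact SetLike.coe_mem _)
    exact ⟨a, by simp [ha]⟩)
  let t : integralClosure ℤ_[2] Ω := ⟨θ, hint hθ⟩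
  have ht : t ^ c = 1 := Subtype.val_injective hθ
  have hGt : G.eval t = 0 := by
    apply Subtype.val_injective
    change algebraMap _ Ω (G.eval t) = 0
    rw [← eval_map_apply, hG, hg, eval_map_algebraMap]
    exact minpoly.aeval L θ
  have hGt2 : red (G.eval (t ^ 2)) = 0 := by
    have h1 : red (G.eval t) = 0 := by rw [hGt, map_zero]
    rw [← eval_map_apply, ← hQ, eval_map] at h1 ⊢
    have h2 := congrArg (frobenius k 2) h1
    rwa [hom_eval₂, map_zero, frobenius_def, ← map_pow, Subsingleton.elim (RingHom.comp _ _)] at h2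
  have hroots : ∀ s : Multiset Ω, (∀ r ∈ s, r ^ c = 1) → ∃ y : integralClosure ℤ_[2] Ω,
      (y : Ω) = (s.map (θ ^ 2 - ·)).prod ∧ (red y = 0 → θ ^ 2 ∈ s) := by
    intro s
    induction s using Multiset.induction_on with
    | empty => exact fun _ ↦ ⟨1, by simp, by simp⟩
    | cons r s ih =>
      intro hs
      obtain ⟨y, hy, hys⟩ := ih fun r hr ↦ hs r (Multiset.mem_cons_of_mem hr)
      have hr := hs r (Multiset.mem_cons_self r s)
      let r' : integralClosure ℤ_[2] Ω := ⟨r, hint hr⟩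
      refine ⟨(t ^ 2 - r') * y, by simp [← hy, t, r'], fun h ↦ ?_⟩
      rw [map_mul, mul_eq_zero, map_sub, sub_eq_zero] at h
      rcases h with h | h
      · have h' : t ^ 2 = r' := eq_of_pow_eq_one_of_map_eq red hc
          (by rw [← pow_mul, mul_comm, pow_mul, ht, one_pow]) (Subtype.val_injective hr) h
        have h'' : θ ^ 2 = r := congrArg Subtype.val h'
        simp [h'']
      · exact Multiset.mem_cons_of_mem (hys h)
  obtain ⟨y, hy, hyr⟩ := hroots g.roots fun r hr ↦ by
    simpa [sub_eq_zero] using (mem_roots'.mp hr).2.dvd hdvd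
  have hyG : y = G.eval (t ^ 2) := by
    apply Subtype.val_injective
    change (y : Ω) = algebraMap _ Ω (G.eval (t ^ 2))
    rw [hy, ← eval_map_apply, hG, (IsAlgClosed.splits g).eval_eq_prod_roots_of_monic hmonic]
    rfl
  have hroot := (mem_roots'.mp (hyr (hyG ▸ hGt2))).2
  rw [IsRoot, hg, eval_map_algebraMap] at hroot
  exact minpoly.exists_algEquiv_of_root' (Algebra.IsAlgebraic.isAlgebraic θ) hroot

theorem exists_algEquiv_eq_pow_two_pow {Ω : Type*} [Field Ω] [IsAlgClosed Ω] [Algebra ℚ_[2] Ω]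
    [Algebra.IsAlgebraic ℚ_[2] Ω]
    [Algebra ℤ_[2] Ω] [IsScalarTower ℤ_[2] ℚ_[2] Ω] {k : Type*} [CommRing k] [IsDomain k]
    [CharP k 2] (red : integralClosure ℤ_[2] Ω →+* k) (L : IntermediateField ℚ_[2] Ω)
    (hL : ∀ x : integralClosure ℤ_[2] Ω, (x : Ω) ∈ L → ∃ n : ℤ, red x = n)
    {c : ℕ} (hc : Odd c) {θ : Ω} (hθ : θ ^ c = 1) (n : ℕ) :
    ∃ τ : Ω ≃ₐ[L] Ω, τ θ = θ ^ 2 ^ n := by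
  obtain ⟨τ, hτ⟩ := exists_algEquiv_eq_sq red L hL hc hθ
  induction n with
  | zero => exact ⟨1, by simp⟩
  | succ n ih =>
    obtain ⟨ρ, hρ⟩ := ih
    exact ⟨τ.trans ρ, by rw [AlgEquiv.trans_apply, hτ, map_pow, hρ, ← pow_mul, pow_succ]⟩

/-- Galois automorphisms act on roots of unity of odd order by powers of Frobenius. -/
theorem exists_apply_eq_pow_two_pow {Ω : Type*} [Field Ω] [Algebra ℚ_[2] Ω]
    [Algebra ℤ_[2] Ω] [IsScalarTower ℤ_[2] ℚ_[2] Ω] {k : Type*} [CommRing k] [IsDomain k]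
    [CharP k 2] (red : integralClosure ℤ_[2] Ω →+* k) (σ : Ω ≃ₐ[ℚ_[2]] Ω)
    (hσ : ∀ x y : integralClosure ℤ_[2] Ω, (y : Ω) = σ x → red x = 0 → red y = 0)
    {c : ℕ} (hc : Odd c) {θ : Ω} (hθ : θ ^ c = 1) : ∃ i : ℕ, σ θ = θ ^ 2 ^ i := by
  have hint {y : Ω} (hy : y ^ c = 1) : IsIntegral ℤ_[2] y :=
    .of_pow hc.pos (hy ▸ isIntegral_one)
  have hσθ : (σ θ) ^ c = 1 := by rw [← map_pow, hθ, map_one]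
  let t : integralClosure ℤ_[2] Ω := ⟨θ, hint hθ⟩
  let s : integralClosure ℤ_[2] Ω := ⟨σ θ, hint hσθ⟩
  have ht : t ^ c = 1 := Subtype.val_injective hθ
  have hs : s ^ c = 1 := Subtype.val_injective hσθ
  have hα : red t ^ 2 ^ c.totient = red t := by
    have h1 : 2 ^ c.totient ≡ 1 [MOD c] := Nat.ModEq.pow_totient (Nat.coprime_two_left.mpr hc)
    have h2 : red t ^ c = 1 := by rw [← map_pow, ht, map_one]
    rw [pow_eq_pow_mod _ h2, h1, ← pow_eq_pow_mod _ h2, pow_one]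
  obtain ⟨H, hH⟩ := exists_intPoly_frobenius_orbit (Nat.totient_pos.mpr hc.pos) hα
  have hred (x : integralClosure ℤ_[2] Ω) : aeval (red x) H = red (aeval x H) :=
    aeval_algHom_apply red.toIntAlgHom x H
  have h1 : red (aeval t H) = 0 := by
    rw [← hred, hH]; exact ⟨0, by simp⟩
  have hcoe (x : integralClosure ℤ_[2] Ω) : ((aeval x H : integralClosure ℤ_[2] Ω) : Ω) =
      aeval (x : Ω) H := (aeval_algebraMap_apply Ω x H).symm
  have h2 : red (aeval s H) = 0 := by
    refine hσ _ _ ?_ h1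
    rw [hcoe, hcoe]
    exact aeval_algHom_apply (σ : Ω →+* Ω).toIntAlgHom θ H
  rw [← hred, hH] at h2
  obtain ⟨i, hi⟩ := h2
  refine ⟨i, congrArg Subtype.val (?_ : s = t ^ 2 ^ i)⟩
  exact eq_of_pow_eq_one_of_map_eq red hc hs
    (by rw [← pow_mul, mul_comm, pow_mul, ht, one_pow]) (by rw [hi, map_pow])

theorem exists_dvd_two_pow_add_one_of_prod_primeFactors_dvd {c r : ℕ} (hc : Odd c)
    (h : ∏ p ∈ c.primeFactors, p ∣ 2 ^ r + 1) : ∃ s : ℕ, c ∣ 2 ^ s + 1 := by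
  set c₁ := ∏ p ∈ c.primeFactors, p with hc₁
  have hodd : Odd c₁ := hc.of_dvd_nat (Nat.prod_primeFactors_dvd c)
  have hdvd : c ∣ c₁ ^ (c + 1) := by
    conv_lhs => rw [← Nat.prod_factorization_pow_eq_self hc.pos.ne']
    rw [hc₁, ← Finset.prod_pow]
    exact Finset.prod_dvd_prod_of_dvd _ _ fun p _ ↦
      pow_dvd_pow p ((Nat.factorization_lt p hc.pos.ne').le.trans c.le_succ)
  refine ⟨r * c₁ ^ c, hdvd.trans ?_⟩
  have h1 : (c₁ : ℤ) ∣ 2 ^ r - (-1) := by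
    rw [sub_neg_eq_add]; exact_mod_cast h
  have h2 := dvd_sub_pow_of_dvd_sub h1 c
  rw [hodd.pow.neg_one_pow, sub_neg_eq_add, ← pow_mul] at h2
  exact_mod_cast h2

/-- case (iii) of Proposition 4.3.  For `ℓ = 2` and `m = 2^a · c`
with `c` odd, a primitive `m`-th root of unity `ζ` in an algebraic closure `Ω`
of `ℚ₂` is conjugate to `ζ⁻¹` over `ℚ₂` iff `c₁ ∣ 2^r + 1` for some `r ≥ 1`,
where `c₁` is the radical of `c`. -/
theorem stmt6 (a c m : ℕ) (hc : 0 < c) (hodd : Odd c)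
    (hm : m = 2 ^ a * c)
    (c₁ : ℕ) (hc₁ : c₁ = ∏ p ∈ c.primeFactors, p)
    (Ω : Type*) [Field Ω] [Algebra ℚ_[2] Ω] [IsAlgClosure ℚ_[2] Ω]
    (ζ : Ω) (hζ : IsPrimitiveRoot ζ m) :
    (∃ σ : Ω ≃ₐ[ℚ_[2]] Ω, σ ζ = ζ⁻¹) ↔ ∃ r : ℕ, 1 ≤ r ∧ c₁ ∣ 2 ^ r + 1 := by
  let : Algebra ℤ_[2] Ω := ((algebraMap ℚ_[2] Ω).comp (algebraMap ℤ_[2] ℚ_[2])).toAlgebra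
  have : IsScalarTower ℤ_[2] ℚ_[2] Ω := .of_algebraMap_eq fun _ ↦ rfl
  have : IsAlgClosed Ω := IsAlgClosure.isAlgClosed ℚ_[2]
  have : Algebra.IsAlgebraic ℚ_[2] Ω := IsAlgClosure.isAlgebraic
  have : CharZero Ω := charZero_of_injective_algebraMap (algebraMap ℚ_[2] Ω).injective
  have : Module.IsTorsionFree ℤ_[2] Ω := Module.IsTorsionFree.trans_faithfulSMul ℤ_[2] ℚ_[2] Ω
  obtain ⟨Q, hQ, h2Q, hσQ⟩ := exists_reduction_of_isAlgClosure Ω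
  let red := Ideal.Quotient.mk Q
  have : Nontrivial (integralClosure ℤ_[2] Ω ⧸ Q) := Ideal.Quotient.nontrivial_iff.mpr hQ.ne_top
  have : CharP (integralClosure ℤ_[2] Ω ⧸ Q) 2 :=
    CharTwo.of_one_ne_zero_of_two_eq_zero one_ne_zero (Ideal.Quotient.eq_zero_iff_mem.mpr h2Q)
  have hred (σ : Ω ≃ₐ[ℚ_[2]] Ω) (x y : integralClosure ℤ_[2] Ω) (h : (y : Ω) = σ x)
      (hx : red x = 0) : red y = 0 :=
    Ideal.Quotient.eq_zero_iff_mem.mpr (hσQ σ x y h (Ideal.Quotient.eq_zero_iff_mem.mp hx))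
  have hη : IsPrimitiveRoot (ζ ^ 2 ^ a) c := hζ.pow (by rw [hm]; positivity) hm
  have htot : 2 ^ c.totient ≡ 1 [MOD c] := Nat.ModEq.pow_totient (Nat.coprime_two_left.mpr hodd)
  subst hc₁
  constructor
  · rintro ⟨σ, hσ⟩
    obtain ⟨i, hi⟩ := exists_apply_eq_pow_two_pow red σ (hred σ) hodd hη.pow_eq_one
    have hdvd : c ∣ 2 ^ i + 1 := by
      rw [← hη.pow_eq_one_iff_dvd, pow_succ, ← hi, map_pow, hσ, inv_pow]
      exact inv_mul_cancel₀ (hη.ne_zero hc.ne')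
    refine ⟨i + c.totient, by have := Nat.totient_pos.mpr hc; lia, ?_⟩
    refine (Nat.prod_primeFactors_dvd c).trans ((Nat.modEq_zero_iff_dvd.mp ?_))
    have h1 := (htot.mul_left (2 ^ i)).add_right 1
    rw [mul_one, ← pow_add] at h1
    exact h1.trans (Nat.modEq_zero_iff_dvd.mpr hdvd)
  · rintro ⟨r, -, hr⟩
    obtain ⟨s, hs⟩ := exists_dvd_two_pow_add_one_of_prod_primeFactors_dvd hodd hr
    have hinv {θ : Ω} (hθ : θ ^ c = 1) : θ ^ 2 ^ s = θ⁻¹ := by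
      refine eq_inv_of_mul_eq_one_left ?_
      obtain ⟨e, he⟩ := hs
      rw [← pow_succ, he, pow_mul, hθ, one_pow]
    obtain ⟨ξ, hξ⟩ := HasEnoughRootsOfUnity.exists_primitiveRoot Ω (2 ^ (a + 1))
    obtain ⟨σ, hσ⟩ : ∃ σ : Ω ≃ₐ[ℚ_[2]] Ω, σ (ξ - 1) = ξ⁻¹ - 1 := by
      have hint : IsIntegral ℤ_[2] (ξ - 1) :=
        (hξ.isIntegral (by positivity)).tower_top.sub isIntegral_one
      refine minpoly.exists_algEquiv_of_root' (Algebra.IsAlgebraic.isAlgebraic _) ?_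
      rw [minpoly.isIntegrallyClosed_eq_field_fractions' ℚ_[2] hint, aeval_map_algebraMap,
        minpoly_sub_one_of_isPrimitiveRoot_two_pow hξ,
        ← minpoly_sub_one_of_isPrimitiveRoot_two_pow hξ.inv]
      exact minpoly.aeval _ _
    obtain ⟨i, hi⟩ := exists_apply_eq_pow_two_pow red σ (hred σ) hodd hη.pow_eq_one
    let L := IntermediateField.adjoin ℚ_[2] {ξ - 1}
    have hξL : ξ ∈ L := by
      simpa using add_mem (IntermediateField.mem_adjoin_simple_self ℚ_[2] (ξ - 1)) (one_mem L)
    have hση : (σ (ζ ^ 2 ^ a)) ^ c = 1 := by rw [← map_pow, hη.pow_eq_one, map_one]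
    obtain ⟨τ, hτ⟩ := exists_algEquiv_eq_pow_two_pow red L
      (exists_int_eq_map_of_mem_adjoin_two_pow_root red hξ) hodd hση
      (s + i * (c.totient - 1))
    let ρ : Ω ≃ₐ[ℚ_[2]] Ω := σ.trans (τ.restrictScalars ℚ_[2])
    have hρη : ρ (ζ ^ 2 ^ a) = (ζ ^ 2 ^ a)⁻¹ := by
      change τ (σ _) = _
      rw [hτ, hi, ← pow_mul, ← pow_add, ← hinv hη.pow_eq_one]
      have he : i + (s + i * (c.totient - 1)) = s + c.totient * i := by
        obtain ⟨e, he⟩ := Nat.exists_eq_add_of_lt (Nat.totient_pos.mpr hc)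
        rw [he]; simp; ring
      have h1 := (htot.pow i).mul_left (2 ^ s)
      rw [one_pow, mul_one, ← pow_mul, ← pow_add] at h1
      rw [he, pow_eq_pow_mod _ hη.pow_eq_one, h1, ← pow_eq_pow_mod _ hη.pow_eq_one]
    have hρξ : ρ ξ = ξ⁻¹ := by
      change τ (σ ξ) = _
      have h1 : σ ξ = ξ⁻¹ := by simpa using hσ
      rw [h1]
      exact τ.commutes ⟨ξ⁻¹, inv_mem hξL⟩
    have hρζ : ρ (ζ ^ c) = (ζ ^ c)⁻¹ := by
      have h1 : (ζ ^ c) ^ 2 ^ (a + 1) = 1 := by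
        rw [← pow_mul, pow_succ, ← mul_assoc, mul_comm c, ← hm, pow_mul, hζ.pow_eq_one, one_pow]
      obtain ⟨j, -, hj⟩ := hξ.eq_pow_of_pow_eq_one h1
      rw [← hj, map_pow, hρξ, inv_pow]
    have hζ0 : ζ ≠ 0 := hζ.ne_zero (by rw [hm]; positivity)
    have hw : (ρ ζ * ζ) ^ (2 ^ a).gcd c = 1 := by
      rw [pow_gcd_eq_one]
      constructor
      · rw [mul_pow, ← map_pow, hρη, inv_mul_cancel₀ (pow_ne_zero _ hζ0)]
      · rw [mul_pow, ← map_pow, hρζ, inv_mul_cancel₀ (pow_ne_zero _ hζ0)]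
    rw [(Nat.coprime_two_left.mpr hodd).pow_left a, pow_one] at hw
    exact ⟨ρ, eq_inv_of_mul_eq_one_left hw⟩
end

section
/- Let G be a group, H a normal subgroup of index 2 with H finite of order n, and τ ∈ G ∖ H with τ² = 1. Fix h₀ ∈ H with h₀ ≠ 1. Consider the polynomial ring ℚ[c_h : h ∈ H, h ≠ h₀] and set c_{h₀} := 0. Define the n×n matrix M, with rows and columns indexed by the elements of H, whose (g, g')-entry is M_{g,g'} = Σ_{β∈H} c_β · c_{g'⁻¹gβ} + Σ_{β∈H} c_β · c_{τ g'⁻¹ g τ β} (note τ σ τ ∈ H for σ ∈ H since H is normal of index 2). Then det M is a nonzero element of the polynomial ring; in fact, for any h₁ ∈ H with h₁ ≠ h₀, the coefficient of the monomial c_{h₁}^{2n} in det M equals 2^n. -/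
/-- Sending `X i` to `X` and every other variable to `0` reads off the coefficients of the
powers of `X i`. -/
theorem MvPolynomial.coeff_aeval_single {σ R : Type*} [CommSemiring R] [DecidableEq σ] (i : σ)
    (p : MvPolynomial σ R) (m : ℕ) :
    (MvPolynomial.aeval (fun j => if j = i then (Polynomial.X : Polynomial R) else 0) p).coeff m
      = MvPolynomial.coeff (Finsupp.single i m) p := by
  induction p using MvPolynomial.induction_on' with
  | add p q hp hq => simp [hp, hq]
  | monomial u a =>
    rw [MvPolynomial.aeval_monomial, MvPolynomial.coeff_monomial, Polynomial.algebraMap_eq,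
      Polynomial.coeff_C_mul]
    by_cases hu : ∃ j ∈ u.support, j ≠ i
    · obtain ⟨j, hj, hji⟩ := hu
      have hne : u ≠ Finsupp.single i m := by
        rintro rfl
        exact hji (by simpa using Finsupp.support_single_subset hj)
      rw [if_neg hne, Finsupp.prod, Finset.prod_eq_zero hj]
      · simp
      · simp [hji, Finsupp.mem_support_iff.mp hj]
    · push Not at hu
      obtain ⟨k, rfl⟩ : ∃ k, u = Finsupp.single i k :=
        Finsupp.support_subset_singleton'.mp fun j hj => by simpa using hu j hj
      rw [Finsupp.prod_single_index (by simp), if_pos rfl, Polynomial.coeff_X_pow]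
      have hiff : Finsupp.single i k = Finsupp.single i m ↔ m = k :=
        (Finsupp.single_injective i).eq_iff.trans eq_comm
      simp [hiff]

theorem sum_ite_eq_mul_ite_mul_eq {Γ R : Type*} [Group Γ] [Fintype Γ] [DecidableEq Γ]
    [CommSemiring R] (a s : Γ) (x : R) :
    ∑ β : Γ, (if β = a then x else 0) * (if s * β = a then x else 0)
      = if s = 1 then x ^ 2 else 0 := by
  rw [Finset.sum_eq_single a (by simp +contextual) (by simp)]
  simp [pow_two]


/-- the determinant computation of Theorem 2.  With `H` a normal
subgroup of index 2 of `G`, `τ ∈ G ∖ H` with `τ² = 1`, variables `c_h` (for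
`h ∈ H`, `h ≠ h₀`, with `c_{h₀} = 0`) and the matrix
`M_{g,g'} = Σ_β c_β c_{g'⁻¹gβ} + Σ_β c_β c_{τg'⁻¹gτβ}`, the determinant of `M`
is a nonzero polynomial: the coefficient of `c_{h₁}^{2n}` in `det M` is `2^n`,
where `n = |H|`. -/
theorem stmt12 {G : Type*} [Group G] [DecidableEq G] (H : Subgroup G) [H.Normal]
    [Fintype H] (hidx : H.index = 2)
    (τ : G) (hτH : τ ∉ H) (hτ2 : τ ^ 2 = 1)
    (h₀ : H) (hh₀ : h₀ ≠ 1)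
    (c : H → MvPolynomial {h : H // h ≠ h₀} ℚ)
    (hc0 : c h₀ = 0)
    (hcX : ∀ h : {h : H // h ≠ h₀}, c h.1 = MvPolynomial.X h)
    (M : Matrix H H (MvPolynomial {h : H // h ≠ h₀} ℚ))
    (hM : ∀ g g' : H, M g g' =
      (∑ β : H, c β * c (g'⁻¹ * g * β)) +
      (∑ β : H, c β * c
        ((⟨τ * ((g'⁻¹ * g : H) : G) * τ, by
            have h1 : τ * τ = 1 := by rwa [pow_two] at hτ2
            have h2 : τ⁻¹ = τ := inv_eq_of_mul_eq_one_left h1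
            have h3 := Subgroup.Normal.conj_mem (inferInstance : H.Normal)
              (((g'⁻¹ * g : H) : G)) (g'⁻¹ * g).2 τ
            rwa [h2] at h3⟩ : H) * β)))
    (h₁ : H) (hh₁ : h₁ ≠ h₀) :
    M.det ≠ 0 ∧
      MvPolynomial.coeff
        (Finsupp.single (⟨h₁, hh₁⟩ : {h : H // h ≠ h₀}) (2 * Fintype.card H))
        M.det = 2 ^ Fintype.card H := by
  classical
  set i : {h : H // h ≠ h₀} := ⟨h₁, hh₁⟩ with hi
  let φ := MvPolynomial.aeval (R := ℚ)
    (fun j : {h : H // h ≠ h₀} => if j = i then (Polynomial.X : Polynomial ℚ) else 0)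
  have hφc (h : H) : φ (c h) = if h = h₁ then Polynomial.X else 0 := by
    by_cases hh : h = h₀
    · subst hh
      rw [hc0, map_zero, if_neg (Ne.symm hh₁)]
    · rw [hcX ⟨h, hh⟩]
      simp [φ, hi]
  have hττ : τ * τ = 1 := by rwa [pow_two] at hτ2
  have hconj (x : G) : τ * x * τ = 1 ↔ x = 1 := by
    have hinv : τ⁻¹ = τ := inv_eq_of_mul_eq_one_left hττ
    have := conj_eq_one_iff (a := τ) (b := x)
    rwa [hinv] at this
  have hφM : φ.mapMatrix M = Matrix.diagonal fun _ => 2 * Polynomial.X ^ 2 := by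
    ext1 g g'
    rw [AlgHom.mapMatrix_apply, Matrix.map_apply, hM, Matrix.diagonal_apply]
    simp only [map_add, map_sum, map_mul, hφc, sum_ite_eq_mul_ite_mul_eq]
    have hone : g'⁻¹ * g = 1 ↔ g = g' := by rw [inv_mul_eq_one, eq_comm]
    simp only [← OneMemClass.coe_eq_one, hconj]
    simp only [OneMemClass.coe_eq_one, hone]
    split_ifs <;> ring
  have hdet : φ M.det = Polynomial.C (2 ^ Fintype.card H) *
      Polynomial.X ^ (2 * Fintype.card H) := by
    rw [AlgHom.map_det, hφM, Matrix.det_diagonal, Finset.prod_const, Finset.card_univ, mul_pow,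
      ← pow_mul, Polynomial.C_pow, map_ofNat]
  have hcoeff : MvPolynomial.coeff (Finsupp.single i (2 * Fintype.card H)) M.det
      = 2 ^ Fintype.card H := by
    rw [← MvPolynomial.coeff_aeval_single]
    change (φ M.det).coeff _ = _
    rw [hdet, Polynomial.coeff_C_mul_X_pow, if_pos rfl]
  refine ⟨fun h => ?_, hcoeff⟩
  rw [h, MvPolynomial.coeff_zero] at hcoeff
  exact pow_ne_zero _ two_ne_zero hcoeff.symm
end
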